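/- arXiv:1304.2619 — 2 statements merged into one kernel-verified Lean document; each statement's English description precedes it below -/
import Mathlib

section
/- Let s > 1/2 and let u ∈ C^∞(ℝ, H^s_+(𝕋)) be a solution of the cubic Szegő equation i∂_t u = Π(|u|²u). Let U(t), V(t) ∈ ℒ(L²_+(𝕋)) solve the linear ODEs dU/dt = B_{u(t)}U, dV/dt = C_{u(t)}V with U(0) = V(0) = I, where B_u := (i/2)H_u² − iT_{|u|²} and C_u := (i/2)K_u² − iT_{|u|²}. Then for every t, U(t) and V(t) are unitary, and H_{u(t)} = U(t) H_{u(0)} U(t)* and K_{u(t)} = V(t) K_{u(0)} V(t)*. -/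
open scoped BigOperators ComplexConjugate

noncomputable section

/-- The Hardy space `L²₊(𝕋)` of the circle, modeled by the Hilbert space `ℓ²(ℕ, ℂ)` of
sequences of nonnegative Fourier (= Taylor) coefficients. -/
abbrev Hardy : Type := lp (fun _ : ℕ => ℂ) 2

/-- The Fourier coefficients of an element of the Hardy space. -/
def coeffs (f : Hardy) : ℕ → ℂ := fun n => f n

/-- Membership in the Sobolev space `Hˢ₊(𝕋)`, expressed on Fourier coefficients. -/
def InHs (s : ℝ) (u : ℕ → ℂ) : Prop :=
  Summable fun k : ℕ => ((1 : ℝ) + (k : ℝ) ^ 2) ^ s * ‖u k‖ ^ 2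

/-- The `Hˢ` norm, expressed on Fourier coefficients. -/
def hsNorm (s : ℝ) (u : ℕ → ℂ) : ℝ :=
  Real.sqrt (∑' k : ℕ, ((1 : ℝ) + (k : ℝ) ^ 2) ^ s * ‖u k‖ ^ 2)

/-- Membership in the Wiener algebra `W`. -/
def InW (u : ℕ → ℂ) : Prop := Summable fun k : ℕ => ‖u k‖

/-- The Wiener norm `‖u‖_W = Σ |û(k)|`. -/
def wienerNorm (u : ℕ → ℂ) : ℝ := ∑' k : ℕ, ‖u k‖

/-- The `L²` norm, expressed on Fourier coefficients. -/
def l2Norm (u : ℕ → ℂ) : ℝ := Real.sqrt (∑' k : ℕ, ‖u k‖ ^ 2)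

/-- The Hankel operator `H_u(h) = Π(u h̄)`, expressed on Fourier coefficients:
`(H_u h)^(n) = Σ_p û(n+p) conj(ĥ(p))`. -/
def hankel (u h : ℕ → ℂ) : ℕ → ℂ := fun n => ∑' p : ℕ, u (n + p) * conj (h p)

/-- The shifted Hankel operator `K_u = S* H_u`. -/
def shiftedHankel (u h : ℕ → ℂ) : ℕ → ℂ := fun n => hankel u h (n + 1)

/-- Fourier coefficients of the pointwise product `fg` of two holomorphic (Hardy class)
functions: the Cauchy product. -/
def mulCoeff (f g : ℕ → ℂ) : ℕ → ℂ := fun n => ∑ p ∈ Finset.range (n + 1), f p * g (n - p)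

/-- Fourier coefficients of `T_{a b̄}(h) = Π(a b̄ h)` for `a, b, h` in the Hardy class. -/
def toeplitzAB (a b h : ℕ → ℂ) : ℕ → ℂ :=
  fun n => ∑' q : ℕ, conj (b q) * mulCoeff a h (n + q)

/-- Fourier coefficients of `T_{ā}(h) = Π(ā h)` for `a, h` in the Hardy class. -/
def toeplitzConj (a h : ℕ → ℂ) : ℕ → ℂ := fun n => ∑' q : ℕ, conj (a q) * h (n + q)

/-- The Szegő nonlinearity `Π(|u|²u) = T_{u ū}(u)`. -/
def szegoNL (u : ℕ → ℂ) : ℕ → ℂ := toeplitzAB u u u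

/-- The operator `B_u = (i/2) H_u² - i T_{|u|²}` of the Lax pair. -/
def laxB (u h : ℕ → ℂ) : ℕ → ℂ := fun n =>
  Complex.I / 2 * hankel u (hankel u h) n - Complex.I * toeplitzAB u u h n

/-- The operator `C_u = (i/2) K_u² - i T_{|u|²}` of the Lax pair. -/
def laxC (u h : ℕ → ℂ) : ℕ → ℂ := fun n =>
  Complex.I / 2 * shiftedHankel u (shiftedHankel u h) n - Complex.I * toeplitzAB u u h n

/-- `u : ℝ → L²₊` is a (smooth in time, `Hˢ`-valued) solution of the cubic Szegő equation
`i ∂_t u = Π(|u|²u)`. -/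
def IsSzegoSolution (s : ℝ) (u : ℝ → Hardy) : Prop :=
  (∀ t, InHs s (coeffs (u t))) ∧ ContDiff ℝ (⊤ : ℕ∞) u ∧
    ∀ t n, HasDerivAt (fun τ : ℝ => coeffs (u τ) n) (-Complex.I * szegoNL (coeffs (u t)) n) t

/-- The Hankel operator with symbol `u` (composed with complex conjugation, which does not
change its range), as a linear map on finitely supported sequences. -/
def hankelLM (u : ℕ → ℂ) : (ℕ →₀ ℂ) →ₗ[ℂ] (ℕ → ℂ) :=
  Finsupp.lsum ℂ fun p => LinearMap.toSpanSingleton ℂ (ℕ → ℂ) fun n => u (n + p)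

/-- The rank of the Hankel operator `H_u`. -/
def hankelRank (u : ℕ → ℂ) : ℕ := Module.finrank ℂ (LinearMap.range (hankelLM u))

/-- The finite rank manifold `𝒱(d)`: `u` with `rk H_u = [(d+1)/2]` and `rk K_u = [d/2]`
(recall `K_u = H_{S*u}`). -/
def InV (d : ℕ) (u : ℕ → ℂ) : Prop :=
  InHs (1 / 2) u ∧ FiniteDimensional ℂ (LinearMap.range (hankelLM u)) ∧
    hankelRank u = (d + 1) / 2 ∧ hankelRank (fun n => u (n + 1)) = d / 2

/-- `w = w^y = (I + y H_u²)⁻¹(1)`, characterized by `(I + y H_u²) w = 1`. -/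
def IsResolventOne (y : ℝ) (u w : ℕ → ℂ) : Prop :=
  Memℓp w 2 ∧ ∀ n, w n + (y : ℂ) * hankel u (hankel u w) n = if n = 0 then 1 else 0

/-- The Hamiltonian vector field `X_{J^y}(u) = 2iy w^y H_u(w^y)` (a pointwise product of two
Hardy class functions), expressed on Fourier coefficients; `w` stands for `w^y`. -/
def XJ (y : ℝ) (u w : ℕ → ℂ) : ℕ → ℂ :=
  fun n => 2 * Complex.I * (y : ℂ) * mulCoeff w (hankel u w) n

/-- The operator `G_u^y(h) = -y w^y Π(conj(w^y) h) + y² (H_u w^y) Π(conj(H_u w^y) h)`;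
`w` stands for `w^y`. -/
def Gop (y : ℝ) (u w h : ℕ → ℂ) : ℕ → ℂ := fun n =>
  -(y : ℂ) * mulCoeff w (toeplitzConj w h) n
    + (y : ℂ) ^ 2 * mulCoeff (hankel u w) (toeplitzConj (hankel u w) h) n

/-- The operator `F_u^y(h) = G_u^y(h) - y² (h | H_u w^y) H_u w^y`; `w` stands for `w^y`. -/
def Fop (y : ℝ) (u w h : ℕ → ℂ) : ℕ → ℂ := fun n =>
  Gop y u w h n - (y : ℂ) ^ 2 * (∑' p : ℕ, h p * conj (hankel u w p)) * hankel u w n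

namespace Szego

open scoped ENNReal Topology
open Filter Set

instance fact_one_ne_top : Fact ((1 : ℝ≥0∞) ≠ ⊤) := ⟨ENNReal.one_ne_top⟩

instance fact_two_ne_top : Fact ((2 : ℝ≥0∞) ≠ ⊤) := ⟨ENNReal.ofNat_ne_top⟩

/-- Complex sequences indexed by `ℕ` of class `ℓᵖ`. -/
abbrev Seq (p : ℝ≥0∞) : Type := lp (fun _ : ℕ => ℂ) p

/-- The Wiener algebra of the Hardy class, as the space `ℓ¹` of Taylor coefficients. -/
abbrev Wiener : Type := Seq 1

/-- Bounded real-linear operators on `ℓᵖ`. They contain both the linear and the antilinear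
operators. -/
abbrev Op (p : ℝ≥0∞) [Fact (1 ≤ p)] : Type := Seq p →L[ℝ] Seq p

variable {p : ℝ≥0∞} [Fact (1 ≤ p)] [hfin : Fact (p ≠ ⊤)]

omit hfin in
lemma toReal_pos (hp : p ≠ ⊤) : 0 < p.toReal :=
  ENNReal.toReal_pos (zero_lt_one.trans_le Fact.out).ne' hp

/-- Two continuous additive maps on `ℓᵖ` which agree on single-coordinate sequences agree. -/
lemma eq_of_single {Y : Type*} [AddCommGroup Y] [TopologicalSpace Y] [T2Space Y]
    {f g : Seq p → Y} (hf : Continuous f) (hg : Continuous g)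
    (hfa : ∀ x y, f (x + y) = f x + f y) (hga : ∀ x y, g (x + y) = g x + g y)
    (h : ∀ k (c : ℂ), f (lp.single p k c) = g (lp.single p k c)) (x : Seq p) : f x = g x := by
  have hx := lp.hasSum_single hfin.out x
  have h1 := hx.map (AddMonoidHom.mk' f hfa) hf
  have h2 := hx.map (AddMonoidHom.mk' g hga) hg
  refine h1.unique ?_
  have h3 : (AddMonoidHom.mk' f hfa ∘ fun k => lp.single p k (x k))
      = AddMonoidHom.mk' g hga ∘ fun k => lp.single p k (x k) := funext fun k => h k _
  rw [h3]
  exact h2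

lemma sum_pull_le (P : ℕ → Prop) [DecidablePred P] (ψ : ℕ → ℕ) (hψ : Set.InjOn ψ {n | P n})
    (h : Seq p) (s : Finset ℕ) :
    ∑ n ∈ s, ‖(if P n then h (ψ n) else 0 : ℂ)‖ ^ p.toReal ≤ ‖h‖ ^ p.toReal := by
  have hp := toReal_pos hfin.out
  calc ∑ n ∈ s, ‖(if P n then h (ψ n) else 0 : ℂ)‖ ^ p.toReal
      = ∑ n ∈ s with P n, ‖h (ψ n)‖ ^ p.toReal := by
        rw [Finset.sum_filter]
        refine Finset.sum_congr rfl fun n _ => ?_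
        split_ifs
        · rfl
        · rw [norm_zero, Real.zero_rpow hp.ne']
    _ = ∑ m ∈ (s.filter P).image ψ, ‖h m‖ ^ p.toReal := by
        rw [Finset.sum_image]
        intro a ha b hb hab
        exact hψ (Finset.mem_filter.1 ha).2 (Finset.mem_filter.1 hb).2 hab
    _ ≤ ‖h‖ ^ p.toReal := lp.sum_rpow_le_norm_rpow hp h _

/-- The operator `(pull h)ₙ = h (ψ n)` if `P n`, and `0` otherwise, for `ψ` injective on `P`. -/
def pull (P : ℕ → Prop) [DecidablePred P] (ψ : ℕ → ℕ) (hψ : Set.InjOn ψ {n | P n}) : Op p :=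
  LinearMap.mkContinuous
    { toFun := fun h => ⟨fun n => if P n then h (ψ n) else 0, memℓp_gen' (sum_pull_le P ψ hψ h)⟩
      map_add' := by
        intro x y
        ext n
        simp only [lp.coeFn_add, Pi.add_apply]
        split_ifs <;> simp
      map_smul' := by
        intro c x
        ext n
        simp only [lp.coeFn_smul, Pi.smul_apply, RingHom.id_apply]
        split_ifs <;> simp } 1 (by
    intro h
    rw [one_mul]
    exact lp.norm_le_of_forall_sum_le (toReal_pos hfin.out) (norm_nonneg h) (sum_pull_le P ψ hψ h))

lemma pull_apply (P : ℕ → Prop) [DecidablePred P] (ψ : ℕ → ℕ) (hψ : Set.InjOn ψ {n | P n})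
    (h : Seq p) (n : ℕ) : pull P ψ hψ h n = if P n then h (ψ n) else 0 := rfl

lemma norm_pull_le (P : ℕ → Prop) [DecidablePred P] (ψ : ℕ → ℕ) (hψ : Set.InjOn ψ {n | P n}) :
    ‖(pull P ψ hψ : Op p)‖ ≤ 1 :=
  LinearMap.mkContinuous_norm_le _ zero_le_one _

/-- Multiplication by `e^{ikx}`. -/
def shiftPow (k : ℕ) : Op p :=
  pull (k ≤ ·) (· - k) (by intro a ha b hb h; simp only [mem_ofPred_eq] at *; omega)

/-- The adjoint of the multiplication by `e^{ikx}`. -/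
def backPow (k : ℕ) : Op p :=
  pull (fun _ => True) (· + k) (by intro a ha b hb h; simp only at h; omega)

/-- Pointwise conjugation of sequences. -/
def conjSeq : Seq p →L[ℝ] Seq p := (starL' ℝ : Seq p ≃L[ℝ] Seq p)

omit hfin in
lemma conjSeq_apply (h : Seq p) (n : ℕ) : conjSeq h n = conj (h n) := rfl

omit hfin in
lemma norm_conjSeq_le : ‖(conjSeq : Op p)‖ ≤ 1 :=
  ContinuousLinearMap.opNorm_le_bound _ zero_le_one fun h => by
    rw [one_mul]; exact (norm_star h).le

/-- The Hankel operator with symbol `e^{ikx}`. -/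
def hankelPow (k : ℕ) : Op p :=
  pull (· ≤ k) (k - ·) (by intro a ha b hb h; simp only [mem_ofPred_eq] at *; omega) * conjSeq

lemma shiftPow_apply (k : ℕ) (h : Seq p) (n : ℕ) :
    shiftPow k h n = if k ≤ n then h (n - k) else 0 := rfl

lemma backPow_apply (k : ℕ) (h : Seq p) (n : ℕ) : backPow k h n = h (n + k) := by
  change (if True then h (n + k) else 0) = h (n + k)
  exact if_pos trivial

lemma hankelPow_apply (k : ℕ) (h : Seq p) (n : ℕ) :
    hankelPow k h n = if n ≤ k then conj (h (k - n)) else 0 := rfl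

lemma norm_shiftPow_le (k : ℕ) : ‖(shiftPow k : Op p)‖ ≤ 1 := norm_pull_le _ _ _

lemma norm_backPow_le (k : ℕ) : ‖(backPow k : Op p)‖ ≤ 1 := norm_pull_le _ _ _

lemma norm_hankelPow_le (k : ℕ) : ‖(hankelPow k : Op p)‖ ≤ 1 :=
  (norm_mul_le _ _).trans (mul_le_one₀ (norm_pull_le _ _ _) (norm_nonneg _) norm_conjSeq_le)

/-- Multiplication by the imaginary unit. -/
def mulI : Op p := Complex.I • 1

omit hfin in
lemma mulI_apply (h : Seq p) : mulI h = Complex.I • h := rfl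

/-- The projection onto the zeroth coordinate. -/
def projZero : Op p :=
  pull (· = 0) id (by intro a ha b hb h; exact h)

lemma projZero_apply (h : Seq p) (n : ℕ) : projZero h n = if n = 0 then h n else 0 := rfl

omit hfin in
lemma summable_smul_of_norm_le (A : ℕ → Op p) (hA : ∀ k, ‖A k‖ ≤ 1) (u : Wiener) :
    Summable fun k => ‖u k • A k‖ := by
  have hu : Summable fun k => ‖u k‖ := by
    simpa using (lp.memℓp u).summable (by simp)
  refine Summable.of_nonneg_of_le (fun _ => norm_nonneg _) (fun k => ?_) hu
  rw [norm_smul]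
  exact mul_le_of_le_one_right (norm_nonneg _) (hA k)

lemma norm_wiener (u : Wiener) : ‖u‖ = ∑' k, ‖u k‖ := by
  simp [lp.norm_eq_tsum_rpow (p := 1) (by simp) u]

/-- The operator `∑ uₖ Aₖ` attached to an `ℓ¹` sequence `u` and to a family `A` of operators of norm
at most `1`. -/
def series (A : ℕ → Op p) (hA : ∀ k, ‖A k‖ ≤ 1) : Wiener →L[ℝ] Op p :=
  LinearMap.mkContinuous
    { toFun := fun u => ∑' k, u k • A k
      map_add' := by
        intro x y
        rw [← (summable_smul_of_norm_le A hA x).of_norm.tsum_add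
          (summable_smul_of_norm_le A hA y).of_norm]
        exact tsum_congr fun k => by rw [lp.coeFn_add, Pi.add_apply, add_smul]
      map_smul' := by
        intro c x
        rw [RingHom.id_apply, ← (summable_smul_of_norm_le A hA x).of_norm.tsum_const_smul]
        exact tsum_congr fun k => by rw [lp.coeFn_smul, Pi.smul_apply, smul_assoc] } 1 (by
    intro u
    rw [one_mul, norm_wiener]
    have hu : Summable fun k => ‖u k‖ := by
      simpa using (lp.memℓp u).summable (by simp)
    refine (norm_tsum_le_tsum_norm (summable_smul_of_norm_le A hA u)).trans ?_
    refine (summable_smul_of_norm_le A hA u).tsum_le_tsum (fun k => ?_) hu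
    rw [norm_smul]
    exact mul_le_of_le_one_right (norm_nonneg _) (hA k))

omit hfin in
lemma series_apply (A : ℕ → Op p) (hA : ∀ k, ‖A k‖ ≤ 1) (u : Wiener) :
    series A hA u = ∑' k, u k • A k := rfl

omit hfin in
lemma series_single (A : ℕ → Op p) (hA : ∀ k, ‖A k‖ ≤ 1) (k : ℕ) (c : ℂ) :
    series A hA (lp.single 1 k c) = c • A k := by
  rw [series_apply, tsum_eq_single k]
  · rw [lp.single_apply_self]
  · intro j hj
    rw [lp.single_apply_ne _ _ _ hj, zero_smul]

/-- The evaluation of a sequence at `n`. -/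
def coord (n : ℕ) : Seq p →L[ℝ] ℂ := lp.evalCLM ℝ (fun _ => ℂ) p n

omit hfin in
lemma hasSum_series_coord (A : ℕ → Op p) (hA : ∀ k, ‖A k‖ ≤ 1) (u : Wiener) (h : Seq p) (n : ℕ) :
    HasSum (fun k => u k * A k h n) (series A hA u h n) := by
  have h1 := (summable_smul_of_norm_le A hA u).of_norm.hasSum
  exact h1.mapL ((coord n).comp (ContinuousLinearMap.apply ℝ (Seq p) h))

/-- The multiplication operator by `u`. -/
def mulOp : Wiener →L[ℝ] Op p := series shiftPow norm_shiftPow_le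

/-- The Toeplitz operator with symbol `ū`. -/
def conjOp : Wiener →L[ℝ] Op p := (series backPow norm_backPow_le).comp conjSeq

/-- The Hankel operator with symbol `u`. -/
def hankelOp : Wiener →L[ℝ] Op p := series hankelPow norm_hankelPow_le

lemma mulOp_single (k : ℕ) (c : ℂ) : mulOp (lp.single 1 k c) = c • (shiftPow k : Op p) :=
  series_single _ _ _ _

omit hfin in
lemma conjSeq_single (k : ℕ) (c : ℂ) :
    conjSeq (lp.single p k c) = (lp.single p k (conj c) : Seq p) := by
  ext n
  rw [conjSeq_apply]
  by_cases h : n = k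
  · subst h; simp
  · rw [lp.single_apply_ne _ _ _ h, lp.single_apply_ne _ _ _ h, map_zero]

lemma conjOp_single (k : ℕ) (c : ℂ) :
    conjOp (lp.single 1 k c) = conj c • (backPow k : Op p) := by
  rw [conjOp, ContinuousLinearMap.comp_apply, conjSeq_single]
  exact series_single _ _ _ _

lemma hankelOp_single (k : ℕ) (c : ℂ) : hankelOp (lp.single 1 k c) = c • (hankelPow k : Op p) :=
  series_single _ _ _ _

lemma hankelOp_coord (u : Wiener) (h : Seq p) (n : ℕ) :
    hankelOp u h n = hankel (u : ℕ → ℂ) (h : ℕ → ℂ) n := by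
  have h1 := (hasSum_series_coord hankelPow norm_hankelPow_le u h n).tsum_eq
  rw [hankelOp, ← h1, hankel]
  have hinj : Function.Injective (fun q : ℕ => n + q) := add_right_injective n
  rw [← hinj.tsum_eq]
  · refine tsum_congr fun q => ?_
    rw [hankelPow_apply, if_pos (Nat.le_add_right n q), Nat.add_sub_cancel_left]
  · intro k hk
    by_contra hk'
    refine hk ?_
    have : ¬ n ≤ k := fun hnk => hk' ⟨k - n, by simp only; omega⟩
    simp only [hankelPow_apply, if_neg this, mul_zero]

lemma mulOp_coord (u : Wiener) (h : Seq p) (n : ℕ) :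
    mulOp u h n = mulCoeff (u : ℕ → ℂ) (h : ℕ → ℂ) n := by
  have h1 := (hasSum_series_coord shiftPow norm_shiftPow_le u h n).tsum_eq
  rw [mulOp, ← h1, mulCoeff, tsum_eq_sum (s := Finset.range (n + 1))]
  · refine Finset.sum_congr rfl fun k hk => ?_
    rw [shiftPow_apply, if_pos (Nat.lt_succ_iff.1 (Finset.mem_range.1 hk))]
  · intro k hk
    rw [Finset.mem_range] at hk
    rw [shiftPow_apply, if_neg (by omega), mul_zero]

lemma conjOp_coord (u : Wiener) (h : Seq p) (n : ℕ) :
    conjOp u h n = ∑' q, conj (u q) * h (n + q) := by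
  have h1 := (hasSum_series_coord backPow norm_backPow_le (conjSeq u) h n).tsum_eq
  rw [conjOp, ContinuousLinearMap.comp_apply, ← h1]
  exact tsum_congr fun q => by rw [backPow_apply, conjSeq_apply]

lemma toeplitz_coord (a b : Wiener) (h : Seq p) (n : ℕ) :
    (conjOp b * mulOp a : Op p) h n = toeplitzAB (a : ℕ → ℂ) (b : ℕ → ℂ) (h : ℕ → ℂ) n := by
  rw [mul_apply_eq_comp, conjOp_coord, toeplitzAB]
  exact tsum_congr fun q => by rw [mulOp_coord]

end Szego

namespace Szego

open scoped ENNReal Topology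
open Filter Set

variable {p : ℝ≥0∞} [Fact (1 ≤ p)] [hfin : Fact (p ≠ ⊤)]

/-- The shift operator `S`. -/
abbrev shift : Op p := shiftPow 1

/-- The backward shift operator `S*`. -/
abbrev back : Op p := backPow 1

lemma back_mul_shift : (back * shift : Op p) = 1 := by
  ext h n
  simp [backPow_apply, shiftPow_apply]

lemma shift_mul_back : (shift * back : Op p) = 1 - projZero := by
  ext h n
  rcases n with _ | n <;> simp [backPow_apply, shiftPow_apply, projZero_apply]

lemma mulI_comm_back : (mulI * back : Op p) = back * mulI := by
  ext h n
  simp [mulI_apply, backPow_apply]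

lemma mulI_comm_projZero : (mulI * projZero : Op p) = projZero * mulI := by
  ext h n
  simp [mulI_apply, projZero_apply]

lemma mulI_comm_mulOp (u : Wiener) : (mulI * mulOp u : Op p) = mulOp u * mulI := by
  refine eq_of_single (f := fun u => (mulI * mulOp u : Op p)) (g := fun u => mulOp u * mulI)
    (by fun_prop) (by fun_prop) (by simp [mul_add]) (by simp [add_mul]) (fun k c => ?_) u
  ext h n
  simp [mulOp_single, mulI_apply, shiftPow_apply]
  ring

lemma mulI_comm_conjOp (u : Wiener) : (mulI * conjOp u : Op p) = conjOp u * mulI := by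
  refine eq_of_single (f := fun u => (mulI * conjOp u : Op p)) (g := fun u => conjOp u * mulI)
    (by fun_prop) (by fun_prop) (by simp [mul_add]) (by simp [add_mul]) (fun k c => ?_) u
  ext h n
  simp [conjOp_single, mulI_apply, backPow_apply]
  ring

lemma hankelOp_mulI (u : Wiener) : (hankelOp u * mulI : Op p) = -(mulI * hankelOp u) := by
  refine eq_of_single (f := fun u => (hankelOp u * mulI : Op p))
    (g := fun u => -(mulI * hankelOp u))
    (by fun_prop) (by fun_prop) (by simp [add_mul]) (by simp [mul_add, add_comm]) (fun k c => ?_) u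
  ext h n
  simp only [hankelOp_single, mulI_apply, mul_apply_eq_comp, smul_apply, neg_apply, lp.coeFn_smul,
    lp.coeFn_neg, Pi.smul_apply, Pi.neg_apply, hankelPow_apply, smul_eq_mul, map_mul,
    Complex.conj_I]
  split_ifs <;> ring_nf

lemma back_mul_hankelOp (u : Wiener) : (back * hankelOp u : Op p) = hankelOp u * shift := by
  refine eq_of_single (f := fun u => (back * hankelOp u : Op p)) (g := fun u => hankelOp u * shift)
    (by fun_prop) (by fun_prop) (by simp [mul_add]) (by simp [add_mul]) (fun k c => ?_) u
  ext h n
  simp only [hankelOp_single, mul_apply_eq_comp, backPow_apply, smul_apply,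
    lp.coeFn_smul, Pi.smul_apply, hankelPow_apply, shiftPow_apply]
  split_ifs <;> first | omega | simp [Nat.sub_sub]

lemma back_mul_conjOp (u : Wiener) : (back * conjOp u : Op p) = conjOp u * back := by
  refine eq_of_single (f := fun u => (back * conjOp u : Op p)) (g := fun u => conjOp u * back)
    (by fun_prop) (by fun_prop) (by simp [mul_add]) (by simp [add_mul]) (fun k c => ?_) u
  ext h n
  simp [conjOp_single, backPow_apply, add_right_comm]

lemma mulOp_mul_shift (u : Wiener) : (mulOp u * shift : Op p) = shift * mulOp u := by
  refine eq_of_single (f := fun u => (mulOp u * shift : Op p)) (g := fun u => shift * mulOp u)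
    (by fun_prop) (by fun_prop) (by simp [add_mul]) (by simp [mul_add]) (fun k c => ?_) u
  ext h n
  simp only [mulOp_single, mul_apply_eq_comp, smul_apply,
    lp.coeFn_smul, Pi.smul_apply, shiftPow_apply]
  split_ifs <;> first | omega | simp [Nat.sub_right_comm]

lemma conjOp_mul_hankelOp (a v : Wiener) :
    (conjOp a * hankelOp v : Op p) = hankelOp v * mulOp a := by
  refine eq_of_single (f := fun a => (conjOp a * hankelOp v : Op p))
    (g := fun a => hankelOp v * mulOp a)
    (by fun_prop) (by fun_prop) (by simp [add_mul]) (by simp [mul_add]) (fun j α => ?_) a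
  refine eq_of_single (f := fun v => (conjOp (lp.single 1 j α) * hankelOp v : Op p))
    (g := fun v => hankelOp v * mulOp (lp.single 1 j α))
    (by fun_prop) (by fun_prop) (by simp [mul_add]) (by simp [add_mul]) (fun k β => ?_) v
  ext h n
  simp only [mulOp_single, conjOp_single, hankelOp_single, mul_apply_eq_comp,
    smul_apply,
    lp.coeFn_smul, Pi.smul_apply, shiftPow_apply, backPow_apply, hankelPow_apply]
  split_ifs <;> first | omega | simp [Nat.sub_sub]
  ring

lemma conjOp_mul_mulOp (a v : Wiener) :
    (conjOp v * mulOp a : Op p)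
      = mulOp a * shift * back * conjOp v + hankelOp a * hankelOp v := by
  refine eq_of_single (f := fun a => (conjOp v * mulOp a : Op p))
    (g := fun a => mulOp a * shift * back * conjOp v + hankelOp a * hankelOp v)
    (by fun_prop) (by fun_prop) (by simp [mul_add])
    (by intro x y; simp only [map_add, add_mul]; abel) (fun j α => ?_) a
  refine eq_of_single (f := fun v => (conjOp v * mulOp (lp.single 1 j α) : Op p))
    (g := fun v => mulOp (lp.single 1 j α) * shift * back * conjOp v
      + hankelOp (lp.single 1 j α) * hankelOp v)
    (by fun_prop) (by fun_prop) (by simp [add_mul])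
    (by intro x y; simp only [map_add, mul_add]; abel) (fun k β => ?_) v
  ext h n
  simp only [mulOp_single, conjOp_single, hankelOp_single, mul_apply_eq_comp, lp.coeFn_add,
    Pi.add_apply, add_apply, smul_apply,
    lp.coeFn_smul, Pi.smul_apply, shiftPow_apply, backPow_apply, hankelPow_apply]
  by_cases h1 : j ≤ n + k
  · by_cases h2 : j + 1 ≤ n
    · have e : k + (n - j) = n + k - j := by omega
      simp [h1, show j ≤ n by omega, show 1 ≤ n - j by omega, show ¬ n ≤ j by omega]
      ring_nf
      rw [e]
    · have e : k - (j - n) = n + k - j := by omega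
      simp [h1, show n ≤ j by omega, show j ≤ k + n by omega, e]
      ring
  · simp [h1, show ¬ j ≤ n by omega, show ¬ j ≤ k + n by omega]

lemma mulOp_mul_projZero_mul_conjOp (a v : Wiener) :
    (mulOp a * projZero * conjOp v : Op p) = hankelOp a * projZero * hankelOp v := by
  refine eq_of_single (f := fun a => (mulOp a * projZero * conjOp v : Op p))
    (g := fun a => hankelOp a * projZero * hankelOp v)
    (by fun_prop) (by fun_prop) (by simp [add_mul]) (by simp [add_mul]) (fun j α => ?_) a
  refine eq_of_single (f := fun v => (mulOp (lp.single 1 j α) * projZero * conjOp v : Op p))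
    (g := fun v => hankelOp (lp.single 1 j α) * projZero * hankelOp v)
    (by fun_prop) (by fun_prop) (by simp [mul_add]) (by simp [mul_add]) (fun k β => ?_) v
  ext h n
  simp only [mulOp_single, conjOp_single, hankelOp_single, mul_apply_eq_comp,
    smul_apply, projZero_apply,
    lp.coeFn_smul, Pi.smul_apply, shiftPow_apply, backPow_apply, hankelPow_apply]
  by_cases h1 : n = j
  · subst h1
    simp
  · by_cases h2 : j ≤ n
    · simp [show ¬ n ≤ j by omega, show n - j ≠ 0 by omega]
    · simp [h2, show j - n ≠ 0 by omega]

lemma hankelOp_conjOp (a v : Wiener) :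
    (hankelOp (conjOp a v) : Op p) = conjOp a * hankelOp v := by
  refine eq_of_single (f := fun a => (hankelOp (conjOp a v) : Op p))
    (g := fun a => conjOp a * hankelOp v)
    (by fun_prop) (by fun_prop) (by simp) (by simp [add_mul]) (fun j α => ?_) a
  refine eq_of_single (f := fun v => (hankelOp (conjOp (lp.single 1 j α) v) : Op p))
    (g := fun v => conjOp (lp.single 1 j α) * hankelOp v)
    (by fun_prop) (by fun_prop) (by simp) (by simp [mul_add]) (fun k β => ?_) v
  have h1 : (backPow j : Op 1) (lp.single 1 k β) = if j ≤ k then lp.single 1 (k - j) β else 0 := by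
    ext n
    rw [backPow_apply]
    split_ifs with h
    · simp only [lp.single_apply, Pi.single_apply]
      exact if_congr (by omega) rfl rfl
    · exact lp.single_apply_ne _ _ _ (by omega)
  have h2 : conj α • (if j ≤ k then (lp.single 1 (k - j) β : Wiener) else 0)
      = if j ≤ k then lp.single 1 (k - j) (conj α * β) else 0 := by
    split_ifs
    · rw [← smul_eq_mul, lp.single_smul]
    · simp
  simp only [conjOp_single, smul_apply, h1, h2]
  ext h n
  by_cases hjk : j ≤ k
  · simp only [hjk, if_true, hankelOp_single, mul_apply_eq_comp,
      smul_apply,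
      lp.coeFn_smul, Pi.smul_apply, backPow_apply, hankelPow_apply]
    split_ifs <;> first | omega | simp [Nat.sub_sub, mul_assoc, add_comm]
  · simp [hjk, hankelOp_single, backPow_apply, hankelPow_apply, show ¬ n + j ≤ k by omega]

lemma hankelOp_mulOp (a v : Wiener) :
    (hankelOp (mulOp a v) : Op p)
      = mulOp a * hankelOp v + hankelOp a * shift * back * conjOp v := by
  refine eq_of_single (f := fun a => (hankelOp (mulOp a v) : Op p))
    (g := fun a => mulOp a * hankelOp v + hankelOp a * shift * back * conjOp v)
    (by fun_prop) (by fun_prop) (by simp)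
    (by intro x y; simp only [map_add, add_mul]; abel) (fun j α => ?_) a
  refine eq_of_single (f := fun v => (hankelOp (mulOp (lp.single 1 j α) v) : Op p))
    (g := fun v => mulOp (lp.single 1 j α) * hankelOp v
      + hankelOp (lp.single 1 j α) * shift * back * conjOp v)
    (by fun_prop) (by fun_prop) (by simp)
    (by intro x y; simp only [map_add, mul_add]; abel) (fun k β => ?_) v
  have h1 : (shiftPow j : Op 1) (lp.single 1 k β) = lp.single 1 (k + j) β := by
    ext n
    rw [shiftPow_apply]
    simp only [lp.single_apply, Pi.single_apply]
    split_ifs <;> first | omega | rfl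
  have h2 : α • (lp.single 1 (k + j) β : Wiener) = lp.single 1 (k + j) (α * β) := by
    rw [← smul_eq_mul, lp.single_smul]
  simp only [mulOp_single, smul_apply, h1, h2]
  ext h n
  simp only [conjOp_single, hankelOp_single, mul_apply_eq_comp, lp.coeFn_add,
    Pi.add_apply, add_apply, smul_apply,
    lp.coeFn_smul, Pi.smul_apply, shiftPow_apply, backPow_apply, hankelPow_apply]
  by_cases h1 : n ≤ k + j
  · by_cases h2 : j ≤ n
    · have e : k - (n - j) = k + j - n := by omega
      simp [h1, h2, e]
      ring
    · have e : k + (j - n) = k + j - n := by omega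
      simp [h1, show ¬ j ≤ n by omega, show n ≤ j by omega, show 1 ≤ j - n by omega]
      ring_nf
      rw [e]
  · simp [h1, show j ≤ n by omega]

end Szego

namespace Szego

open scoped ENNReal Topology
open Filter Set

variable {p : ℝ≥0∞} [Fact (1 ≤ p)] [hfin : Fact (p ≠ ⊤)]

lemma projZero_mul_shift : (projZero * shift : Op p) = 0 := by
  ext h n
  by_cases hn : n = 0 <;> simp [projZero_apply, shiftPow_apply, hn]

lemma back_mul_projZero : (back * projZero : Op p) = 0 := by
  ext h n
  simp [projZero_apply, backPow_apply]

lemma hankelOp_mulI_apply (u : Wiener) : (hankelOp (mulI u) : Op p) = mulI * hankelOp u := by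
  refine eq_of_single (f := fun u => (hankelOp (mulI u) : Op p)) (g := fun u => mulI * hankelOp u)
    (by fun_prop) (by fun_prop) (by simp) (by simp [mul_add]) (fun k c => ?_) u
  rw [mulI_apply, ← lp.single_smul, hankelOp_single, hankelOp_single]
  ext h n
  simp [mulI_apply, mul_assoc]

/-- The Toeplitz operator with symbol `|u|²`. -/
def toepOp (u : Wiener) : Op p := conjOp u * mulOp u

/-- The shifted Hankel operator with symbol `u`. -/
def shiftedHankelOp : Wiener →L[ℝ] Op p :=
  (ContinuousLinearMap.mul ℝ (Op p) back).comp hankelOp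

/-- The Szegő vector field `-iΠ(|u|²u)` on the Wiener algebra. -/
def vectorField (u : Wiener) : Wiener := -mulI (conjOp u (mulOp u u))

/-- The first Lax operator. -/
def laxOpB (u : Wiener) : Op p := mulI * ((1 / 2 : ℝ) • (hankelOp u * hankelOp u) - toepOp u)

/-- The second Lax operator. -/
def laxOpC (u : Wiener) : Op p :=
  mulI * ((1 / 2 : ℝ) • (shiftedHankelOp u * shiftedHankelOp u) - toepOp u)

lemma shiftedHankelOp_eq (u : Wiener) : (shiftedHankelOp u : Op p) = back * hankelOp u := rfl

lemma shiftedHankelOp_eq' (u : Wiener) : (shiftedHankelOp u : Op p) = hankelOp u * shift :=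
  back_mul_hankelOp u

lemma shiftedHankelOp_mulI (u : Wiener) :
    (shiftedHankelOp u * mulI : Op p) = -(mulI * shiftedHankelOp u) := by
  rw [shiftedHankelOp_eq, mul_assoc, hankelOp_mulI, mul_neg, ← mul_assoc, ← mul_assoc,
    mulI_comm_back]

lemma shiftedHankelOp_sq (u : Wiener) :
    (shiftedHankelOp u * shiftedHankelOp u : Op p)
      = hankelOp u * hankelOp u - hankelOp u * projZero * hankelOp u := by
  have h := shift_mul_back (p := p)
  nth_rewrite 1 [shiftedHankelOp_eq']
  rw [shiftedHankelOp_eq]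
  linear_combination (norm := noncomm_ring) hankelOp u * h * hankelOp u

lemma toepOp_eq (u : Wiener) : (toepOp u : Op p)
    = mulOp u * shift * back * conjOp u + hankelOp u * hankelOp u := conjOp_mul_mulOp u u

lemma projZero_mul_toepOp (u : Wiener) :
    (projZero * toepOp u : Op p) = projZero * (hankelOp u * hankelOp u) := by
  have h1 := projZero_mul_shift (p := p)
  have h2 := mulOp_mul_shift (p := p) u
  rw [toepOp_eq]
  linear_combination (norm := noncomm_ring) projZero * h2 * back * conjOp u
    + h1 * mulOp u * back * conjOp u

lemma toepOp_mul_projZero (u : Wiener) :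
    (toepOp u * projZero : Op p) = hankelOp u * hankelOp u * projZero := by
  have h1 := back_mul_projZero (p := p)
  have h2 := back_mul_conjOp (p := p) u
  rw [toepOp_eq]
  linear_combination (norm := noncomm_ring) mulOp u * shift * h2 * projZero
    + mulOp u * shift * conjOp u * h1

lemma toepOp_mul_shift (u : Wiener) : (toepOp u * shift : Op p)
    = shift * toepOp u + hankelOp u * hankelOp u * shift
      - shift * (shiftedHankelOp u * shiftedHankelOp u) := by
  have h1 := back_mul_conjOp (p := p) u
  have h2 := back_mul_shift (p := p)
  have h3 := mulOp_mul_shift (p := p) u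
  have h4 := shift_mul_back (p := p)
  have h5 := mulOp_mul_projZero_mul_conjOp (p := p) u u
  rw [toepOp_eq, shiftedHankelOp_sq]
  linear_combination (norm := noncomm_ring) mulOp u * shift * h1 * shift
    + mulOp u * shift * conjOp u * h2 + h3 * conjOp u - shift * mulOp u * h4 * conjOp u + shift * h5

lemma hankelOp_cubic (u : Wiener) :
    (hankelOp (conjOp u (mulOp u u)) : Op p) = toepOp u * hankelOp u + hankelOp u * toepOp u
      - hankelOp u * hankelOp u * hankelOp u := by
  have h1 := conjOp_mul_hankelOp (p := p) u u
  have h2 := toepOp_eq (p := p) u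
  have h3 : (toepOp u : Op p) = conjOp u * mulOp u := rfl
  rw [hankelOp_conjOp, hankelOp_mulOp]
  linear_combination (norm := noncomm_ring) h1 * shift * back * conjOp u - hankelOp u * h2
    - h3 * hankelOp u

lemma hankelOp_vectorField (u : Wiener) : (hankelOp (vectorField u) : Op p)
    = laxOpB u * hankelOp u - hankelOp u * laxOpB u := by
  have h := hankelOp_mulI (p := p) u
  rw [vectorField, map_neg, hankelOp_mulI_apply, hankelOp_cubic, laxOpB, ← mul_assoc, h]
  simp only [mul_sub, sub_mul, mul_add, neg_mul, mul_smul_comm, smul_mul_assoc, mul_assoc]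
  module

lemma shiftedHankelOp_cubic (u : Wiener) :
    (back * hankelOp (conjOp u (mulOp u u)) : Op p)
      = toepOp u * shiftedHankelOp u + shiftedHankelOp u * toepOp u
      - shiftedHankelOp u * shiftedHankelOp u * shiftedHankelOp u := by
  have h1 := toepOp_mul_shift (p := p) u
  rw [back_mul_hankelOp, hankelOp_cubic]
  nth_rewrite 1 2 [shiftedHankelOp_eq']
  nth_rewrite 1 [shiftedHankelOp_eq']
  linear_combination (norm := noncomm_ring) hankelOp u * h1

lemma shiftedHankelOp_vectorField (u : Wiener) : (shiftedHankelOp (vectorField u) : Op p)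
    = laxOpC u * shiftedHankelOp u - shiftedHankelOp u * laxOpC u := by
  have h := shiftedHankelOp_mulI (p := p) u
  rw [shiftedHankelOp_eq, vectorField, map_neg, hankelOp_mulI_apply, mul_neg, ← mul_assoc,
    ← mulI_comm_back, mul_assoc, shiftedHankelOp_cubic, laxOpC, ← mul_assoc, h]
  simp only [mul_sub, sub_mul, mul_add, neg_mul, mul_smul_comm, smul_mul_assoc, mul_assoc]
  module

lemma projZero_mul_laxOpB (u : Wiener) : (projZero * laxOpB u : Op p)
    = -((1 / 2 : ℝ) • (projZero * (mulI * (hankelOp u * hankelOp u)))) := by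
  rw [laxOpB, ← mul_assoc, ← mul_assoc, ← mulI_comm_projZero, mul_assoc, mul_sub,
    projZero_mul_toepOp]
  simp only [mul_sub, mul_smul_comm, mul_assoc]
  module

lemma laxOpB_mul_projZero (u : Wiener) : (laxOpB u * projZero : Op p)
    = -((1 / 2 : ℝ) • (mulI * (hankelOp u * hankelOp u) * projZero)) := by
  rw [laxOpB, mul_assoc, sub_mul, toepOp_mul_projZero]
  simp only [mul_sub, mul_smul_comm, smul_mul_assoc, mul_assoc]
  module

lemma laxOpC_eq (u : Wiener) : (laxOpC u : Op p)
    = laxOpB u - (1 / 2 : ℝ) • (mulI * (hankelOp u * projZero * hankelOp u)) := by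
  rw [laxOpC, laxOpB, shiftedHankelOp_sq]
  simp only [mul_sub, smul_sub, mul_smul_comm]
  module

lemma mulI_comm_toepOp (u : Wiener) : (mulI * toepOp u : Op p) = toepOp u * mulI := by
  rw [toepOp, ← mul_assoc, mulI_comm_conjOp, mul_assoc, mulI_comm_mulOp, mul_assoc]

lemma mulI_comm_laxOpB (u : Wiener) : (mulI * laxOpB u : Op p) = laxOpB u * mulI := by
  have h : (hankelOp u * hankelOp u * mulI : Op p) = mulI * (hankelOp u * hankelOp u) := by
    rw [mul_assoc, hankelOp_mulI, mul_neg, ← mul_assoc, hankelOp_mulI, neg_mul, neg_neg, mul_assoc]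
  rw [laxOpB, mul_assoc mulI _ mulI, sub_mul, smul_mul_assoc, h, ← mulI_comm_toepOp, mul_sub,
    mul_smul_comm]

lemma inner_mulOp (u : Wiener) (x y : Hardy) :
    inner ℂ (mulOp u x) y = inner ℂ x (conjOp u y) := by
  refine eq_of_single (f := fun u : Wiener => inner ℂ (mulOp u x) y)
    (g := fun u => inner ℂ x (conjOp u y)) (by fun_prop) (by fun_prop)
    (by simp) (by simp) (fun k c => ?_) u
  rw [mulOp_single, conjOp_single, smul_apply, smul_apply, inner_smul_left, inner_smul_right]
  congr 1
  refine eq_of_single (f := fun x : Hardy => inner ℂ (shiftPow k x) y)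
    (g := fun x => inner ℂ x (backPow k y)) (by fun_prop) (by fun_prop)
    (by simp) (by simp) (fun j d => ?_) x
  have h : (shiftPow k : Op 2) (lp.single 2 j d) = lp.single 2 (j + k) d := by
    ext n
    rw [shiftPow_apply]
    simp only [lp.single_apply, Pi.single_apply]
    split_ifs <;> first | omega | rfl
  rw [h, lp.inner_single_left, lp.inner_single_left, backPow_apply]

lemma inner_hankelOp (u : Wiener) (x y : Hardy) :
    inner ℂ (hankelOp u x) y = inner ℂ (hankelOp u y) x := by
  refine eq_of_single (f := fun u : Wiener => inner ℂ (hankelOp u x) y)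
    (g := fun u => inner ℂ (hankelOp u y) x) (by fun_prop) (by fun_prop)
    (by simp) (by simp) (fun k c => ?_) u
  rw [hankelOp_single, smul_apply, smul_apply, inner_smul_left, inner_smul_left]
  congr 1
  refine eq_of_single (f := fun x : Hardy => inner ℂ (hankelPow k x) y)
    (g := fun x => inner ℂ (hankelPow k y) x) (by fun_prop) (by fun_prop)
    (by simp) (by simp) (fun j d => ?_) x
  have h : (hankelPow k : Op 2) (lp.single 2 j d)
      = if j ≤ k then lp.single 2 (k - j) (conj d) else 0 := by
    ext n
    rw [hankelPow_apply]
    split_ifs with h1 h2 h2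
    · simp only [lp.single_apply, Pi.single_apply]
      split_ifs <;> first | omega | simp
    · rw [lp.single_apply_ne _ _ _ (by omega)]
      simp
    · rw [lp.single_apply_ne _ _ _ (by omega)]
    · rfl
  rw [h, lp.inner_single_right, hankelPow_apply]
  split_ifs
  · rw [lp.inner_single_left]
    simp [mul_comm]
  · simp

lemma inner_shiftedHankelOp (u : Wiener) (x y : Hardy) :
    inner ℂ (shiftedHankelOp u x) y = inner ℂ (shiftedHankelOp u y) x := by
  have h : ∀ z w : Hardy, inner ℂ (shift z) w = inner ℂ z (back w) := fun z w => by
    have := inner_mulOp (lp.single 1 1 1) z w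
    rwa [mulOp_single, conjOp_single, map_one, one_smul, one_smul] at this
  calc inner ℂ (shiftedHankelOp u x) y = inner ℂ ((hankelOp u * shift : Op 2) x) y := by
        rw [shiftedHankelOp_eq']
    _ = inner ℂ (hankelOp u y) (shift x) := by rw [mul_apply_eq_comp, inner_hankelOp]
    _ = inner ℂ (shiftedHankelOp u y) x := by
        rw [← inner_conj_symm, h, inner_conj_symm]
        rfl

/-- If `A` is symmetric in the antilinear sense, then `i(A²/2 - T)` is skew-adjoint. -/
lemma inner_skew (u : Wiener) (A : Op 2) (hA : ∀ x y, inner ℂ (A x) y = inner ℂ (A y) x)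
    (x y : Hardy) :
    inner ℂ ((mulI * ((1 / 2 : ℝ) • (A * A) - toepOp u) : Op 2) x) y
      = -inner ℂ x ((mulI * ((1 / 2 : ℝ) • (A * A) - toepOp u) : Op 2) y) := by
  have h1 : inner ℂ (A (A x)) y = inner ℂ x (A (A y)) := by
    rw [hA, ← inner_conj_symm x, hA (A y), inner_conj_symm]
  have h2 : inner ℂ (conjOp u (mulOp u x)) y = inner ℂ x (conjOp u (mulOp u y)) := by
    rw [← inner_mulOp, ← inner_conj_symm, ← inner_mulOp, inner_conj_symm]
  have h3 : ∀ z : Hardy, (1 / 2 : ℝ) • z = (1 / 2 : ℂ) • z := fun z => by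
    ext n
    simp
  simp only [mul_apply_eq_comp, sub_apply, smul_apply, toepOp, mulI_apply, inner_smul_left,
    inner_smul_right, inner_sub_left, inner_sub_right, h1, h2, h3]
  simp [map_ofNat]

lemma inner_laxOpB (u : Wiener) (x y : Hardy) :
    inner ℂ (laxOpB u x) y = -inner ℂ x (laxOpB u y) :=
  inner_skew u _ (inner_hankelOp u) x y

lemma inner_laxOpC (u : Wiener) (x y : Hardy) :
    inner ℂ (laxOpC u x) y = -inner ℂ x (laxOpC u y) :=
  inner_skew u _ (inner_shiftedHankelOp u) x y

end Szego

namespace Szego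

open scoped ENNReal Topology
open Filter Set

lemma eq_of_hasDerivWithinAt_zero {E : Type*} [NormedAddCommGroup E] [NormedSpace ℝ E] {f : ℝ → E}
    {a t : ℝ} (h : ∀ τ ∈ uIcc a t, HasDerivWithinAt f 0 (uIcc a t) τ) : f t = f a := by
  have h1 := (convex_uIcc a t).norm_image_sub_le_of_norm_hasDerivWithin_le (C := 0) h
    (fun τ _ => by simp) left_mem_uIcc right_mem_uIcc
  rw [zero_mul] at h1
  exact sub_eq_zero.1 (norm_le_zero_iff.1 h1)

section Ring

variable {R : Type*} [NormedRing R] [NormedAlgebra ℝ R] [CompleteSpace R]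

lemma hasDerivWithinAt_inv {P Q B : ℝ → R} {s : Set ℝ} (hPQ : ∀ τ ∈ s, P τ * Q τ = 1)
    (hQP : ∀ τ ∈ s, Q τ * P τ = 1) {τ : ℝ} (hτ : τ ∈ s)
    (hP : HasDerivWithinAt P (B τ * P τ) s τ) : HasDerivWithinAt Q (-(Q τ * B τ)) s τ := by
  have h1 : ∀ σ ∈ s, Q σ = Ring.inverse (P σ) := fun σ hσ =>
    (Ring.inverse_unit (⟨P σ, Q σ, hPQ σ hσ, hQP σ hσ⟩ : Rˣ)).symm
  have h2 := (hasFDerivAt_ringInverse (𝕜 := ℝ) (⟨P τ, Q τ, hPQ τ hτ, hQP τ hτ⟩ : Rˣ))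
  have h3 := HasFDerivAt.comp_hasDerivWithinAt τ h2 hP
  refine (h3.congr h1 (h1 τ hτ)).congr_deriv ?_
  change -(Q τ * (B τ * P τ) * Q τ) = _
  rw [mul_assoc, mul_assoc, hPQ τ hτ, mul_one]

lemma hasDerivAt_exp_sub_smul (a τ : ℝ) (D : R) :
    HasDerivAt (fun σ : ℝ => NormedSpace.exp ((σ - a) • D)) (NormedSpace.exp ((τ - a) • D) * D) τ := by
  have h := (hasDerivAt_exp_smul_const (𝕂 := ℝ) D (τ - a)).scomp τ ((hasDerivAt_id τ).sub_const a)
  exact h.congr_deriv (one_smul _ _)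

lemma hasDerivAt_exp_sub_smul' (a τ : ℝ) (D : R) :
    HasDerivAt (fun σ : ℝ => NormedSpace.exp ((σ - a) • D)) (D * NormedSpace.exp ((τ - a) • D)) τ := by
  have h := (hasDerivAt_exp_smul_const' (𝕂 := ℝ) D (τ - a)).scomp τ
    ((hasDerivAt_id τ).sub_const a)
  exact h.congr_deriv (one_smul _ _)

lemma exp_neg_mul_exp (D : R) : NormedSpace.exp (-D) * NormedSpace.exp D = 1 := by
  let _ : NormedAlgebra ℚ R := NormedAlgebra.restrictScalars ℚ ℝ R
  rw [← NormedSpace.exp_add_of_commute (Commute.neg_left (Commute.refl D)), neg_add_cancel,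
    NormedSpace.exp_zero]

lemma eq_exp_mul {X : ℝ → R} {D : R} {a t : ℝ}
    (h : ∀ τ ∈ uIcc a t, HasDerivWithinAt X (D * X τ) (uIcc a t) τ) :
    X t = NormedSpace.exp ((t - a) • D) * X a := by
  have h1 : NormedSpace.exp ((t - a) • -D) * X t = NormedSpace.exp ((a - a) • -D) * X a := by
    refine eq_of_hasDerivWithinAt_zero
      (f := fun σ => NormedSpace.exp ((σ - a) • -D) * X σ) fun τ hτ => ?_
    refine (((hasDerivAt_exp_sub_smul a τ (-D)).hasDerivWithinAt).mul (h τ hτ)).congr_deriv ?_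
    noncomm_ring
  rw [sub_self, zero_smul, NormedSpace.exp_zero, one_mul, smul_neg] at h1
  have h2 := exp_neg_mul_exp (-((t - a) • D))
  rw [neg_neg] at h2
  rw [← h1, ← mul_assoc, h2, one_mul]

lemma eq_mul_exp {X : ℝ → R} {D : R} {a t : ℝ}
    (h : ∀ τ ∈ uIcc a t, HasDerivWithinAt X (-(X τ * D)) (uIcc a t) τ) :
    X t = X a * NormedSpace.exp (-((t - a) • D)) := by
  have h1 : X t * NormedSpace.exp ((t - a) • D) = X a * NormedSpace.exp ((a - a) • D) := by
    refine eq_of_hasDerivWithinAt_zero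
      (f := fun σ => X σ * NormedSpace.exp ((σ - a) • D)) fun τ hτ => ?_
    refine ((h τ hτ).mul ((hasDerivAt_exp_sub_smul' a τ D).hasDerivWithinAt)).congr_deriv ?_
    noncomm_ring
  rw [sub_self, zero_smul, NormedSpace.exp_zero, mul_one] at h1
  have h2 := exp_neg_mul_exp (-((t - a) • D))
  rw [neg_neg] at h2
  rw [← h1, mul_assoc, h2, mul_one]

end Ring

/-- A pair of operator-valued evolutions `P`, `V`, with inverses `Q`, `Y`, driven by the Lax
operators of `w` on the segment between `a` and `t`, and conjugating the Hankel operators. -/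
structure LaxFrame (a t : ℝ) (w : ℝ → Wiener) (P Q V Y : ℝ → Op 2) : Prop where
  derivP : ∀ τ ∈ uIcc a t, HasDerivWithinAt P (laxOpB (w τ) * P τ) (uIcc a t) τ
  derivV : ∀ τ ∈ uIcc a t, HasDerivWithinAt V (laxOpC (w τ) * V τ) (uIcc a t) τ
  mulPQ : ∀ τ ∈ uIcc a t, P τ * Q τ = 1
  mulQP : ∀ τ ∈ uIcc a t, Q τ * P τ = 1
  mulVY : ∀ τ ∈ uIcc a t, V τ * Y τ = 1
  mulYV : ∀ τ ∈ uIcc a t, Y τ * V τ = 1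
  initP : P a = 1
  initV : V a = 1
  conjH : ∀ τ ∈ uIcc a t, hankelOp (w τ) = P τ * hankelOp (w a) * Q τ
  conjK : ∀ τ ∈ uIcc a t, shiftedHankelOp (w τ) = V τ * shiftedHankelOp (w a) * Y τ

namespace LaxFrame

variable {a t : ℝ} {w : ℝ → Wiener} {P Q V Y : ℝ → Op 2}

lemma mono (h : LaxFrame a t w P Q V Y) {t' : ℝ} (ht' : t' ∈ uIcc a t) :
    LaxFrame a t' w P Q V Y := by
  have hs : uIcc a t' ⊆ uIcc a t := uIcc_subset_uIcc left_mem_uIcc ht'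
  exact ⟨fun τ hτ => (h.derivP τ (hs hτ)).mono hs, fun τ hτ => (h.derivV τ (hs hτ)).mono hs,
    fun τ hτ => h.mulPQ τ (hs hτ), fun τ hτ => h.mulQP τ (hs hτ), fun τ hτ => h.mulVY τ (hs hτ),
    fun τ hτ => h.mulYV τ (hs hτ), h.initP, h.initV, fun τ hτ => h.conjH τ (hs hτ),
    fun τ hτ => h.conjK τ (hs hτ)⟩

lemma derivQ (h : LaxFrame a t w P Q V Y) {τ : ℝ} (hτ : τ ∈ uIcc a t) :
    HasDerivWithinAt Q (-(Q τ * laxOpB (w τ))) (uIcc a t) τ :=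
  hasDerivWithinAt_inv (B := fun τ => laxOpB (w τ)) h.mulPQ h.mulQP hτ (h.derivP τ hτ)

lemma derivY (h : LaxFrame a t w P Q V Y) {τ : ℝ} (hτ : τ ∈ uIcc a t) :
    HasDerivWithinAt Y (-(Y τ * laxOpC (w τ))) (uIcc a t) τ :=
  hasDerivWithinAt_inv (B := fun τ => laxOpC (w τ)) h.mulVY h.mulYV hτ (h.derivV τ hτ)

lemma initQ (h : LaxFrame a t w P Q V Y) : Q a = 1 := by
  simpa [h.initP] using h.mulPQ a left_mem_uIcc

lemma initY (h : LaxFrame a t w P Q V Y) : Y a = 1 := by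
  simpa [h.initV] using h.mulVY a left_mem_uIcc

lemma mulI_comm_P (h : LaxFrame a t w P Q V Y) : mulI * P t = P t * mulI := by
  have h1 : Q t * mulI * P t = Q a * mulI * P a := by
    refine eq_of_hasDerivWithinAt_zero (f := fun σ => Q σ * mulI * P σ) fun τ hτ => ?_
    refine (((h.derivQ hτ).mul_const _).mul (h.derivP τ hτ)).congr_deriv ?_
    linear_combination (norm := noncomm_ring) Q τ * mulI_comm_laxOpB (p := 2) (w τ) * P τ
  rw [h.initP, h.initQ, one_mul, mul_one] at h1
  calc mulI * P t = P t * Q t * mulI * P t := by rw [h.mulPQ t right_mem_uIcc, one_mul]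
    _ = P t * (Q t * mulI * P t) := by simp only [mul_assoc]
    _ = P t * mulI := by rw [h1]

lemma mulI_comm_Q (h : LaxFrame a t w P Q V Y) : mulI * Q t = Q t * mulI := by
  have h1 := h.mulI_comm_P
  have h2 := h.mulPQ t right_mem_uIcc
  have h3 := h.mulQP t right_mem_uIcc
  linear_combination (norm := noncomm_ring) -(Q t * h1 * Q t) + Q t * mulI * h2
    - h3 * mulI * Q t

/-- The generator of the evolution of the constant function in the moving frame. -/
def generator (A : Op 2) : Op 2 := (1 / 2 : ℝ) • (mulI * (A * A))

lemma Q_mul_projZero (h : LaxFrame a t w P Q V Y) : Q t * projZero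
    = NormedSpace.exp ((t - a) • generator (hankelOp (w a))) * projZero := by
  have h1 := eq_exp_mul (X := fun σ => Q σ * projZero) (D := generator (hankelOp (w a))) (a := a)
    (t := t) fun τ hτ => by
      refine ((h.derivQ hτ).mul_const _).congr_deriv ?_
      have hB := laxOpB_mul_projZero (p := 2) (w τ)
      have hJ := (h.mono hτ).mulI_comm_Q
      have hQP := h.mulQP τ hτ
      rw [neg_mul, mul_assoc, hB, h.conjH τ hτ, mul_neg, neg_neg, generator, mul_smul_comm,
        smul_mul_assoc]
      congr 1
      linear_combination (norm := noncomm_ring) -(hJ * P τ * hankelOp (w a) * Q τ * P τ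
        * hankelOp (w a) * Q τ * projZero) + mulI * hQP * hankelOp (w a) * Q τ * P τ
        * hankelOp (w a) * Q τ * projZero + mulI * hankelOp (w a) * hQP
        * hankelOp (w a) * Q τ * projZero
  simpa [h.initQ] using h1

lemma projZero_mul_P (h : LaxFrame a t w P Q V Y) : projZero * P t
    = projZero * NormedSpace.exp (-((t - a) • generator (hankelOp (w a)))) := by
  have h1 := eq_mul_exp (X := fun σ => projZero * P σ) (D := generator (hankelOp (w a))) (a := a)
    (t := t) fun τ hτ => by
      refine ((h.derivP τ hτ).const_mul _).congr_deriv ?_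
      have hB := projZero_mul_laxOpB (p := 2) (w τ)
      have hJ := (h.mono hτ).mulI_comm_P
      have hQP := h.mulQP τ hτ
      rw [← mul_assoc, hB, h.conjH τ hτ, neg_mul, generator, mul_smul_comm, smul_mul_assoc]
      congr 2
      linear_combination (norm := noncomm_ring) projZero * hJ * hankelOp (w a) * Q τ * P τ
        * hankelOp (w a) * Q τ * P τ + projZero * P τ * mulI * hankelOp (w a) * hQP
        * hankelOp (w a) * Q τ * P τ + projZero * P τ * mulI * hankelOp (w a)
        * hankelOp (w a) * hQP
  simpa [h.initP] using h1

/-- The operator driving the evolution of `Q V`. -/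
def driver (a τ : ℝ) (A : Op 2) : Op 2 :=
  -((1 / 2 : ℝ) • (mulI * (A * (NormedSpace.exp ((τ - a) • generator A) * projZero
    * (projZero * NormedSpace.exp (-((τ - a) • generator A)))) * A)))

lemma projZero_mul_projZero {p : ℝ≥0∞} [Fact (1 ≤ p)] [Fact (p ≠ ⊤)] :
    (projZero * projZero : Op p) = projZero := by
  ext h n
  by_cases hn : n = 0 <;> simp [projZero_apply, hn]

lemma Q_mul_sub_mul_P (h : LaxFrame a t w P Q V Y) :
    Q t * (laxOpC (w t) - laxOpB (w t)) * P t = driver a t (hankelOp (w a)) := by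
  have hJ := h.mulI_comm_Q
  have hQP := h.mulQP t right_mem_uIcc
  have hE := projZero_mul_projZero (p := 2)
  rw [driver, ← h.Q_mul_projZero, ← h.projZero_mul_P, laxOpC_eq, sub_sub_cancel_left, mul_neg,
    neg_mul, h.conjH t right_mem_uIcc, mul_smul_comm, smul_mul_assoc]
  congr 2
  linear_combination (norm := noncomm_ring) -(hJ * P t * hankelOp (w a) * Q t * projZero * P t
        * hankelOp (w a) * Q t * P t) + mulI * hQP * hankelOp (w a) * Q t * projZero * P t
        * hankelOp (w a) * Q t * P t + mulI * hankelOp (w a) * Q t * projZero * P t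
        * hankelOp (w a) * hQP - mulI * hankelOp (w a) * Q t * hE * P t * hankelOp (w a)

variable {w' : ℝ → Wiener} {P' Q' V' Y' : ℝ → Op 2}

lemma inv_mul_eq_one (h : LaxFrame a t w P Q V Y) (h' : LaxFrame a t w' P' Q' V' Y')
    (hw : w a = w' a) : Y' t * P' t * (Q t * V t) = 1 := by
  have h1 : Y' t * P' t * (Q t * V t) = Y' a * P' a * (Q a * V a) := by
    refine eq_of_hasDerivWithinAt_zero (f := fun σ => Y' σ * P' σ * (Q σ * V σ)) fun τ hτ => ?_
    refine (((h'.derivY hτ).mul (h'.derivP τ hτ)).mul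
      ((h.derivQ hτ).mul (h.derivV τ hτ))).congr_deriv ?_
    have e1 := (h.mono hτ).Q_mul_sub_mul_P
    have e2 := (h'.mono hτ).Q_mul_sub_mul_P
    have e3 := h.mulPQ τ hτ
    have e4 := h'.mulPQ τ hτ
    rw [← hw, ← e1] at e2
    simp only [Pi.mul_apply]
    linear_combination (norm := noncomm_ring) Y' τ * e4 * (laxOpC (w' τ) - laxOpB (w' τ))
      * P' τ * Q τ * V τ
      - Y' τ * P' τ * e2 * Q τ * V τ
      - Y' τ * P' τ * Q τ * (laxOpC (w τ) - laxOpB (w τ)) * e3 * V τ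
  rw [h1, h'.initY, h'.initP, h.initQ, h.initV]
  simp

end LaxFrame

/-- A Hankel symbol is determined by the compressions of `S*ⁿ H` to the constants. -/
lemma eq_of_projZero_mul_back_pow {u v : Wiener}
    (h : ∀ n : ℕ, (projZero * back ^ n * hankelOp u * projZero : Op 2)
      = projZero * back ^ n * hankelOp v * projZero) : u = v := by
  have hb : ∀ (n m : ℕ) (x : Hardy), (back ^ n : Op 2) x m = x (m + n) := by
    intro n
    induction n with
    | zero => intro m x; simp
    | succ n ih =>
      intro m x
      rw [pow_succ, mul_apply_eq_comp, ih, backPow_apply, add_assoc]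
  have hE : (projZero : Op 2) (lp.single 2 0 1) = lp.single 2 0 1 := by
    ext m
    by_cases hm : m = 0
    · simp [projZero_apply, hm]
    · simp [projZero_apply, hm]
  have hu : ∀ (u : Wiener) (n : ℕ),
      (projZero * back ^ n * hankelOp u * projZero : Op 2) (lp.single 2 0 1) 0 = u n := by
    intro u n
    rw [mul_apply_eq_comp, hE, mul_apply_eq_comp, mul_apply_eq_comp, projZero_apply, if_pos rfl, hb,
      hankelOp_coord, hankel, tsum_eq_single 0]
    · simp
    · intro m hm
      simp [hm]
  ext n
  rw [← hu u, ← hu v, h]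

/-- Two Hankel operators which are conjugate, together with their shifts, by the same operator
fixing the constants, coincide. -/
lemma eq_of_conj {u v : Wiener} {Ω Ω' : Op 2} (hΩ : Ω' * Ω = 1) (h1 : Ω * projZero = projZero)
    (h2 : projZero * Ω = projZero) (hH : hankelOp u = Ω * hankelOp v * Ω')
    (hK : shiftedHankelOp u = Ω * shiftedHankelOp v * Ω') : u = v := by
  have h3 : Ω' * projZero = projZero := by
    nth_rewrite 1 [← h1]
    rw [← mul_assoc, hΩ, one_mul]
  have hS : ∀ n : ℕ, (back ^ n * hankelOp u : Op 2) = Ω * back ^ n * hankelOp v * Ω' := by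
    intro n
    induction n with
    | zero => simpa using hH
    | succ n ih =>
      have e1 : (back * hankelOp u : Op 2) = hankelOp u * shift := back_mul_hankelOp u
      have e2 : (Ω * back * Ω') * hankelOp u = back * hankelOp u := by
        rw [← shiftedHankelOp_eq u, hK, hH, shiftedHankelOp_eq]
        linear_combination (norm := noncomm_ring) Ω * back * hΩ * hankelOp v * Ω'
      have e3 : (back ^ n * hankelOp u : Op 2) = Ω * back ^ n * Ω' * hankelOp u := by
        rw [ih, hH]
        linear_combination (norm := noncomm_ring) -(Ω * back ^ n * hΩ * hankelOp v * Ω')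
      calc (back ^ (n + 1) * hankelOp u : Op 2) = back ^ n * hankelOp u * shift := by
            rw [pow_succ, mul_assoc, e1, mul_assoc]
        _ = Ω * back ^ n * Ω' * (back * hankelOp u) := by rw [e3, e1]; simp only [mul_assoc]
        _ = Ω * back ^ n * Ω' * (Ω * back * hankelOp v * Ω') := by
            rw [← shiftedHankelOp_eq u, hK, shiftedHankelOp_eq]; simp only [mul_assoc]
        _ = _ := by
            rw [pow_succ]
            linear_combination (norm := noncomm_ring) Ω * back ^ n * hΩ * back * hankelOp v * Ω'
  refine eq_of_projZero_mul_back_pow fun n => ?_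
  rw [mul_assoc projZero, hS]
  linear_combination (norm := noncomm_ring) h2 * back ^ n * hankelOp v * Ω' * projZero
    + projZero * back ^ n * hankelOp v * h3

namespace LaxFrame

variable {a t : ℝ} {w w' : ℝ → Wiener} {P Q V Y P' Q' V' Y' : ℝ → Op 2}

/-- A path admitting a Lax frame is determined by its initial value. -/
theorem unique (h : LaxFrame a t w P Q V Y) (h' : LaxFrame a t w' P' Q' V' Y')
    (hw : w a = w' a) : w t = w' t := by
  have ht : t ∈ uIcc a t := right_mem_uIcc
  have e1 := h.inv_mul_eq_one h' hw
  have hPQ := h.mulPQ t ht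
  have hQP := h.mulQP t ht
  have hVY := h.mulVY t ht
  have hPQ' := h'.mulPQ t ht
  have hQP' := h'.mulQP t ht
  have hVY' := h'.mulVY t ht
  have hYV' := h'.mulYV t ht
  have hQE : Q t * projZero = Q' t * projZero := by
    rw [h.Q_mul_projZero, h'.Q_mul_projZero, hw]
  have hEP : projZero * P t = projZero * P' t := by
    rw [h.projZero_mul_P, h'.projZero_mul_P, hw]
  have e2 : Q t * V t = Q' t * V' t := by
    linear_combination (norm := noncomm_ring) Q' t * V' t * e1 - hQP' * Q t * V t
      - Q' t * hVY' * P' t * Q t * V t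
  have e3 : V t = P t * Q' t * V' t := by
    linear_combination (norm := noncomm_ring) P t * e2 - hPQ * V t
  have e4 : Y t = Y' t * P' t * Q t := by
    linear_combination (norm := noncomm_ring) Y' t * P' t * Q t * hVY - e1 * Y t
  refine eq_of_conj (Ω := P t * Q' t) (Ω' := P' t * Q t) ?_ ?_ ?_ ?_ ?_
  · linear_combination (norm := noncomm_ring) P' t * hQP * Q' t + hPQ'
  · rw [mul_assoc, ← hQE, ← mul_assoc, hPQ, one_mul]
  · rw [← mul_assoc, hEP, mul_assoc, hPQ', mul_one]
  · rw [h.conjH t ht, h'.conjH t ht, hw]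
    linear_combination (norm := noncomm_ring) -(P t * hQP' * hankelOp (w' a) * Q' t * P' t * Q t)
      - P t * hankelOp (w' a) * hQP' * Q t
  · rw [h.conjK t ht, h'.conjK t ht, hw, e3, e4]
    simp only [mul_assoc]

end LaxFrame

end Szego

namespace Szego

open scoped ENNReal NNReal Topology
open Filter Set Metric

/-- Existence of solutions of an autonomous differential equation which remain in a ball. -/
lemma exists_solution_mem_closedBall {E : Type*} [NormedAddCommGroup E] [NormedSpace ℝ E]
    [CompleteSpace E] {f : E → E} {x₀ : E} {r L K : ℝ≥0} (hL : ∀ x ∈ closedBall x₀ r, ‖f x‖ ≤ L)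
    (hK : LipschitzOnWith K f (closedBall x₀ r)) {δ : ℝ} (hδ : 0 ≤ δ) (hLδ : L * δ ≤ r) (a : ℝ) :
    ∃ α : ℝ → E, α a = x₀ ∧ ∀ τ ∈ Icc (a - δ) (a + δ),
      HasDerivWithinAt α (f (α τ)) (Icc (a - δ) (a + δ)) τ ∧ α τ ∈ closedBall x₀ r := by
  have ha : a ∈ Icc (a - δ) (a + δ) := ⟨by linarith, by linarith⟩
  have hf : IsPicardLindelof (fun _ => f) (⟨a, ha⟩ : Icc (a - δ) (a + δ)) x₀ r 0 L K :=
    .of_time_independent hL hK (by simpa using hLδ)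
  obtain ⟨α, hα⟩ := ODE.FunSpace.exists_isFixedPt_next hf (mem_closedBall_self le_rfl)
  refine ⟨α.compProj, ?_, fun t ht => ⟨?_, α.compProj_mem_closedBall hf.mul_max_le⟩⟩
  · change α.compProj ((⟨a, ha⟩ : Icc (a - δ) (a + δ)) : ℝ) = x₀
    rw [ODE.FunSpace.compProj_val, ← hα, ODE.FunSpace.next_apply₀]
  · apply (ODE.hasDerivWithinAt_picard_Icc ha hf.continuousOn_uncurry
      α.continuous_compProj.continuousOn (fun _ ht' => α.compProj_mem_closedBall hf.mul_max_le)
      x₀ ht).congr_of_mem _ ht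
    intro t' ht'
    nth_rw 1 [← hα]
    rw [ODE.FunSpace.compProj_of_mem ht', ODE.FunSpace.next_apply]

section BddLip

variable {X Y Y' Z : Type*} [NormedAddCommGroup X] [NormedAddCommGroup Y] [NormedAddCommGroup Y']
  [NormedAddCommGroup Z]

/-- The map `f` is bounded and Lipschitz continuous on `S`. -/
def BddLip (S : Set X) (f : X → Y) : Prop :=
  ∃ C : ℝ, 0 ≤ C ∧ (∀ x ∈ S, ‖f x‖ ≤ C) ∧ ∀ x ∈ S, ∀ y ∈ S, ‖f x - f y‖ ≤ C * ‖x - y‖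

variable {S : Set X}

lemma bddLip_id {R : ℝ} (hS : ∀ x ∈ S, ‖x‖ ≤ R) : BddLip S (id : X → X) :=
  ⟨max R 1, by positivity, fun x hx => (hS x hx).trans (le_max_left _ _),
    fun x _ y _ => le_mul_of_one_le_left (norm_nonneg _) (le_max_right _ _)⟩

lemma BddLip.clm [NormedSpace ℝ Y] [NormedSpace ℝ Z] {f : X → Y} (hf : BddLip S f)
    (A : Y →L[ℝ] Z) : BddLip S fun x => A (f x) := by
  obtain ⟨C, hC, h1, h2⟩ := hf
  refine ⟨‖A‖ * C, by positivity, fun x hx => A.le_opNorm_of_le (h1 x hx), fun x hx y hy => ?_⟩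
  rw [← map_sub, mul_assoc]
  exact A.le_opNorm_of_le (h2 x hx y hy)

lemma BddLip.bilin [NormedSpace ℝ Y] [NormedSpace ℝ Y'] [NormedSpace ℝ Z] {f : X → Y}
    {g : X → Y'} (hf : BddLip S f) (hg : BddLip S g)
    (A : Y →L[ℝ] Y' →L[ℝ] Z) : BddLip S fun x => A (f x) (g x) := by
  obtain ⟨C, hC, h1, h2⟩ := hf
  obtain ⟨D, hD, h3, h4⟩ := hg
  refine ⟨max (‖A‖ * C * D) (‖A‖ * C * D + ‖A‖ * C * D), by positivity, fun x hx => ?_,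
    fun x hx y hy => ?_⟩
  · exact ((A.le_opNorm₂ _ _).trans (by gcongr <;> [exact h1 x hx; exact h3 x hx])).trans
      (le_max_left _ _)
  · have e : A (f x) (g x) - A (f y) (g y) = A (f x - f y) (g x) + A (f y) (g x - g y) := by
      simp
    rw [e]
    calc ‖A (f x - f y) (g x) + A (f y) (g x - g y)‖
        ≤ ‖A‖ * (C * ‖x - y‖) * D + ‖A‖ * C * (D * ‖x - y‖) := by
          refine (norm_add_le _ _).trans (add_le_add ?_ ?_)
          · exact (A.le_opNorm₂ _ _).trans
              (by gcongr <;> [exact h2 x hx y hy; exact h3 x hx])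
          · exact (A.le_opNorm₂ _ _).trans
              (by gcongr <;> [exact h1 y hy; exact h4 x hx y hy])
      _ = (‖A‖ * C * D + ‖A‖ * C * D) * ‖x - y‖ := by ring
      _ ≤ _ := by gcongr; exact le_max_right _ _

lemma BddLip.mul {R : Type*} [NormedRing R] [NormedAlgebra ℝ R] {f g : X → R} (hf : BddLip S f)
    (hg : BddLip S g) : BddLip S fun x => f x * g x :=
  hf.bilin hg (ContinuousLinearMap.mul ℝ R)

lemma BddLip.sub {f g : X → Y} (hf : BddLip S f) (hg : BddLip S g) :
    BddLip S fun x => f x - g x := by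
  obtain ⟨C, hC, h1, h2⟩ := hf
  obtain ⟨D, hD, h3, h4⟩ := hg
  refine ⟨C + D, by positivity, fun x hx =>
    (norm_sub_le _ _).trans (add_le_add (h1 x hx) (h3 x hx)), fun x hx y hy => ?_⟩
  rw [sub_sub_sub_comm, add_mul]
  exact (norm_sub_le _ _).trans (add_le_add (h2 x hx y hy) (h4 x hx y hy))

lemma BddLip.prodMk {f : X → Y} {g : X → Y'} (hf : BddLip S f) (hg : BddLip S g) :
    BddLip S fun x => (f x, g x) := by
  obtain ⟨C, hC, h1, h2⟩ := hf
  obtain ⟨D, hD, h3, h4⟩ := hg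
  refine ⟨max C D, by positivity, fun x hx => max_le_max (h1 x hx) (h3 x hx), fun x hx y hy => ?_⟩
  rw [Prod.mk_sub_mk, max_mul_of_nonneg _ _ (norm_nonneg _)]
  exact max_le_max (h2 x hx y hy) (h4 x hx y hy)

lemma BddLip.lipschitzOnWith {f : X → Y} (hf : BddLip S f) :
    ∃ C : ℝ≥0, (∀ x ∈ S, ‖f x‖ ≤ C) ∧ LipschitzOnWith C f S := by
  obtain ⟨C, hC, h1, h2⟩ := hf
  refine ⟨⟨C, hC⟩, h1, LipschitzOnWith.of_dist_le_mul fun x hx y hy => ?_⟩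
  rw [dist_eq_norm, dist_eq_norm]
  exact h2 x hx y hy

variable {p : ℝ≥0∞} [Fact (1 ≤ p)] [hfin : Fact (p ≠ ⊤)] {w : X → Wiener}

lemma BddLip.mul_const_left {R : Type*} [NormedRing R] [NormedAlgebra ℝ R] {f : X → R}
    (hf : BddLip S f) (c : R) : BddLip S fun x => c * f x :=
  hf.clm (ContinuousLinearMap.mul ℝ R c)

lemma BddLip.const_smul [NormedSpace ℝ Y] {f : X → Y} (hf : BddLip S f)
    (c : ℝ) : BddLip S fun x => c • f x :=
  hf.clm (c • ContinuousLinearMap.id ℝ Y)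

lemma bddLip_toepOp (hw : BddLip S w) : BddLip S fun x => (toepOp (w x) : Op p) := by
  have h1 : BddLip S fun x => (conjOp (w x) : Op p) := hw.clm conjOp
  have h2 : BddLip S fun x => (mulOp (w x) : Op p) := hw.clm mulOp
  exact h1.mul h2

lemma bddLip_laxOpB (hw : BddLip S w) : BddLip S fun x => (laxOpB (w x) : Op p) := by
  have h1 : BddLip S fun x => (hankelOp (w x) : Op p) := hw.clm hankelOp
  have h2 := (h1.mul h1).const_smul (1 / 2)
  have h3 := h2.sub (bddLip_toepOp hw)
  exact h3.mul_const_left mulI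

lemma bddLip_laxOpC (hw : BddLip S w) : BddLip S fun x => (laxOpC (w x) : Op p) := by
  have h1 : BddLip S fun x => (shiftedHankelOp (w x) : Op p) := hw.clm shiftedHankelOp
  have h2 := (h1.mul h1).const_smul (1 / 2)
  have h3 := h2.sub (bddLip_toepOp hw)
  exact h3.mul_const_left mulI

lemma bddLip_vectorField (hw : BddLip S w) : BddLip S fun x => vectorField (w x) := by
  have h1 : BddLip S fun x => (conjOp (w x) : Op 1) := hw.clm conjOp
  have h2 : BddLip S fun x => (mulOp (w x) : Op 1) := hw.clm mulOp
  have h3 : BddLip S fun x => (mulOp (w x) : Op 1) (w x) :=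
    h2.bilin hw (ContinuousLinearMap.id ℝ (Op 1))
  have h4 : BddLip S fun x => (conjOp (w x) : Op 1) ((mulOp (w x) : Op 1) (w x)) :=
    h1.bilin h3 (ContinuousLinearMap.id ℝ (Op 1))
  exact h4.clm (-mulI)

end BddLip

lemma conj_eq_of_lax {R : Type*} [NormedRing R] [NormedAlgebra ℝ R] [CompleteSpace R] {a t : ℝ}
    {P Q B H : ℝ → R} (hPQ : ∀ τ ∈ uIcc a t, P τ * Q τ = 1) (hQP : ∀ τ ∈ uIcc a t, Q τ * P τ = 1)
    (hP : ∀ τ ∈ uIcc a t, HasDerivWithinAt P (B τ * P τ) (uIcc a t) τ)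
    (hH : ∀ τ ∈ uIcc a t, HasDerivWithinAt H (B τ * H τ - H τ * B τ) (uIcc a t) τ) :
    Q t * H t * P t = Q a * H a * P a := by
  refine eq_of_hasDerivWithinAt_zero (f := fun σ => Q σ * H σ * P σ) fun τ hτ => ?_
  refine (((hasDerivWithinAt_inv hPQ hQP hτ (hP τ hτ)).mul (hH τ hτ)).mul
    (hP τ hτ)).congr_deriv ?_
  simp only [Pi.mul_apply]
  noncomm_ring

lemma isUnit_of_norm_sub_one_le {R : Type*} [NormedRing R] [CompleteSpace R] {x : R}
    (h : ‖x - 1‖ ≤ 1 / 2) : IsUnit x := by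
  have h1 : ‖1 - x‖ < 1 := by rw [norm_sub_rev]; linarith
  simpa using (Units.oneSub (1 - x) h1).isUnit

/-- A solution of the Szegő equation in the Wiener algebra, together with the evolutions of its Lax
operators, yields a Lax frame. -/
lemma laxFrame_of_solution {a t : ℝ} {w : ℝ → Wiener} {P V : ℝ → Op 2}
    (hw : ∀ τ ∈ uIcc a t, HasDerivWithinAt w (vectorField (w τ)) (uIcc a t) τ)
    (hP : ∀ τ ∈ uIcc a t, HasDerivWithinAt P (laxOpB (w τ) * P τ) (uIcc a t) τ)
    (hV : ∀ τ ∈ uIcc a t, HasDerivWithinAt V (laxOpC (w τ) * V τ) (uIcc a t) τ)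
    (hPu : ∀ τ ∈ uIcc a t, IsUnit (P τ)) (hVu : ∀ τ ∈ uIcc a t, IsUnit (V τ))
    (hPa : P a = 1) (hVa : V a = 1) :
    LaxFrame a t w P (fun τ => Ring.inverse (P τ)) V (fun τ => Ring.inverse (V τ)) := by
  have hPQ : ∀ τ ∈ uIcc a t, P τ * Ring.inverse (P τ) = 1 := fun τ hτ =>
    Ring.mul_inverse_cancel _ (hPu τ hτ)
  have hQP : ∀ τ ∈ uIcc a t, Ring.inverse (P τ) * P τ = 1 := fun τ hτ =>
    Ring.inverse_mul_cancel _ (hPu τ hτ)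
  have hVY : ∀ τ ∈ uIcc a t, V τ * Ring.inverse (V τ) = 1 := fun τ hτ =>
    Ring.mul_inverse_cancel _ (hVu τ hτ)
  have hYV : ∀ τ ∈ uIcc a t, Ring.inverse (V τ) * V τ = 1 := fun τ hτ =>
    Ring.inverse_mul_cancel _ (hVu τ hτ)
  refine ⟨hP, hV, hPQ, hQP, hVY, hYV, hPa, hVa, fun τ hτ => ?_, fun τ hτ => ?_⟩
  · have hs : uIcc a τ ⊆ uIcc a t := uIcc_subset_uIcc left_mem_uIcc hτ
    have h := conj_eq_of_lax (a := a) (t := τ) (H := fun σ => hankelOp (w σ))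
      (B := fun σ => laxOpB (w σ)) (fun σ hσ => hPQ σ (hs hσ))
      (fun σ hσ => hQP σ (hs hσ)) (fun σ hσ => (hP σ (hs hσ)).mono hs) (fun σ hσ => by
        rw [← hankelOp_vectorField]
        exact hankelOp.hasFDerivAt.comp_hasDerivWithinAt σ ((hw σ (hs hσ)).mono hs))
    simp only [hPa, Ring.inverse_one, one_mul, mul_one] at h
    rw [← h]
    linear_combination (norm := noncomm_ring) -(hPQ τ hτ * hankelOp (w τ) * P τ
      * Ring.inverse (P τ)) - hankelOp (w τ) * hPQ τ hτ
  · have hs : uIcc a τ ⊆ uIcc a t := uIcc_subset_uIcc left_mem_uIcc hτ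
    have h := conj_eq_of_lax (a := a) (t := τ) (H := fun σ => shiftedHankelOp (w σ))
      (B := fun σ => laxOpC (w σ)) (fun σ hσ => hVY σ (hs hσ))
      (fun σ hσ => hYV σ (hs hσ)) (fun σ hσ => (hV σ (hs hσ)).mono hs) (fun σ hσ => by
        rw [← shiftedHankelOp_vectorField]
        exact shiftedHankelOp.hasFDerivAt.comp_hasDerivWithinAt σ ((hw σ (hs hσ)).mono hs))
    simp only [hVa, Ring.inverse_one, one_mul, mul_one] at h
    rw [← h]
    linear_combination (norm := noncomm_ring) -(hVY τ hτ * shiftedHankelOp (w τ) * V τ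
      * Ring.inverse (V τ)) - shiftedHankelOp (w τ) * hVY τ hτ

/-- Local existence in the Wiener algebra, with a time of existence which only depends on the size
of the initial datum. -/
theorem exists_laxFrame {k : ℝ} (hk : 0 ≤ k) : ∃ δ > 0, ∀ w₀ : Wiener, ‖w₀‖ ≤ k → ∀ a t : ℝ,
    |t - a| ≤ δ → ∃ (w : ℝ → Wiener) (P Q V Y : ℝ → Op 2),
      w a = w₀ ∧ LaxFrame a t w P Q V Y ∧ ‖w t‖ ≤ k + 1 := by
  set S : Set (Wiener × Op 2 × Op 2) := {x | ‖x‖ ≤ k + 2} with hS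
  set f : Wiener × Op 2 × Op 2 → Wiener × Op 2 × Op 2 := fun x =>
    (vectorField x.1, laxOpB x.1 * x.2.1, laxOpC x.1 * x.2.2) with hf
  have hid : BddLip S (id : Wiener × Op 2 × Op 2 → _) := bddLip_id fun x hx => hx
  have hw : BddLip S fun x : Wiener × Op 2 × Op 2 => x.1 :=
    hid.clm (ContinuousLinearMap.fst ℝ _ _)
  have hPV := hid.clm (ContinuousLinearMap.snd ℝ _ _)
  have hP : BddLip S fun x : Wiener × Op 2 × Op 2 => x.2.1 :=
    hPV.clm (ContinuousLinearMap.fst ℝ _ _)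
  have hV : BddLip S fun x : Wiener × Op 2 × Op 2 => x.2.2 :=
    hPV.clm (ContinuousLinearMap.snd ℝ _ _)
  obtain ⟨C, hC1, hC2⟩ := ((bddLip_vectorField hw).prodMk
    (((bddLip_laxOpB hw).mul hP).prodMk ((bddLip_laxOpC hw).mul hV))).lipschitzOnWith
  have hC : (0 : ℝ) < C + 1 := by positivity
  refine ⟨1 / 2 / (C + 1), by positivity, fun w₀ hw₀ a t hat => ?_⟩
  set δ : ℝ := 1 / 2 / (C + 1) with hδ
  have hδ0 : 0 ≤ δ := by positivity
  set r : ℝ≥0 := 1 / 2 with hr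
  have hr' : (r : ℝ) = 1 / 2 := by simp [hr]
  have hball : closedBall ((w₀, 1, 1) : Wiener × Op 2 × Op 2) r ⊆ S := by
    intro x hx
    have h1 : ‖((w₀, 1, 1) : Wiener × Op 2 × Op 2)‖ ≤ k + 1 := by
      refine max_le (by linarith) (max_le ?_ ?_) <;>
        exact ContinuousLinearMap.norm_id_le.trans (by linarith)
    rw [mem_closedBall, dist_eq_norm, hr'] at hx
    have h2 := norm_le_norm_add_norm_sub' x ((w₀, 1, 1) : Wiener × Op 2 × Op 2)
    change ‖x‖ ≤ k + 2
    linarith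
  have hCδ : C * δ ≤ r := by
    rw [hr', hδ, mul_div_assoc', div_le_iff₀ hC]
    nlinarith [C.2]
  obtain ⟨α, hα0, hα⟩ := exists_solution_mem_closedBall (f := f) (x₀ := (w₀, 1, 1))
    (fun x hx => hC1 x (hball hx)) (hC2.mono hball) hδ0 hCδ a
  have hs : uIcc a t ⊆ Icc (a - δ) (a + δ) := by
    rw [abs_le] at hat
    exact uIcc_subset_Icc ⟨by linarith, by linarith⟩ ⟨by linarith, by linarith⟩
  have hd : ∀ τ ∈ uIcc a t, HasDerivWithinAt α (f (α τ)) (uIcc a t) τ := fun τ hτ =>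
    ((hα τ (hs hτ)).1).mono hs
  have hb : ∀ τ ∈ uIcc a t, ‖(α τ).1 - w₀‖ ≤ 1 / 2 ∧ ‖(α τ).2.1 - 1‖ ≤ 1 / 2
      ∧ ‖(α τ).2.2 - 1‖ ≤ 1 / 2 := fun τ hτ => by
    have h := (hα τ (hs hτ)).2
    rw [mem_closedBall, dist_eq_norm, hr'] at h
    exact ⟨(norm_fst_le _).trans h, (norm_fst_le _).trans ((norm_snd_le _).trans h),
      (norm_snd_le _).trans ((norm_snd_le _).trans h)⟩
  refine ⟨fun τ => (α τ).1, _, _, _, _, congrArg Prod.fst hα0,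
    laxFrame_of_solution (P := fun τ => (α τ).2.1) (V := fun τ => (α τ).2.2)
    (fun τ hτ => ?_) (fun τ hτ => ?_) (fun τ hτ => ?_) (fun τ hτ => ?_) (fun τ hτ => ?_)
    (congrArg (fun x => x.2.1) hα0) (congrArg (fun x => x.2.2) hα0), ?_⟩
  · exact (ContinuousLinearMap.fst ℝ _ _).hasFDerivAt.comp_hasDerivWithinAt τ (hd τ hτ)
  · exact ((ContinuousLinearMap.fst ℝ _ _).comp
      (ContinuousLinearMap.snd ℝ _ _)).hasFDerivAt.comp_hasDerivWithinAt τ (hd τ hτ)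
  · exact ((ContinuousLinearMap.snd ℝ _ _).comp
      (ContinuousLinearMap.snd ℝ _ _)).hasFDerivAt.comp_hasDerivWithinAt τ (hd τ hτ)
  · exact isUnit_of_norm_sub_one_le (hb τ hτ).2.1
  · exact isUnit_of_norm_sub_one_le (hb τ hτ).2.2
  · have h1 := (hb t right_mem_uIcc).1
    have h2 := norm_le_norm_add_norm_sub' (α t).1 w₀
    change ‖(α t).1‖ ≤ k + 1
    linarith

end Szego

namespace Szego

open scoped ENNReal NNReal Topology
open Filter Set Metric

lemma summable_norm_wiener (u : Wiener) : Summable fun k => ‖u k‖ := by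
  simpa using (lp.memℓp u).summable (by simp)

lemma norm_wiener_le_iff {u : Wiener} {C : ℝ} : ‖u‖ ≤ C ↔ ∀ s : Finset ℕ, ∑ k ∈ s, ‖u k‖ ≤ C := by
  rw [norm_wiener]
  exact ⟨fun h s => ((summable_norm_wiener u).sum_le_tsum s fun _ _ => norm_nonneg _).trans h,
    fun h => (summable_norm_wiener u).tsum_le_of_sum_le h⟩

lemma isClosed_norm_wiener_le {X : Type*} [TopologicalSpace X] {w : X → Wiener}
    (hw : ∀ n, Continuous fun x => w x n) (k : ℝ) : IsClosed {x | ‖w x‖ ≤ k} := by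
  simp only [norm_wiener_le_iff, ofPred_forall]
  exact isClosed_iInter fun s => isClosed_le
    (continuous_finsetSum _ fun n _ => (hw n).norm) continuous_const

/-- Mean value inequality for paths in the Wiener algebra which are differentiable
coefficientwise. -/
lemma norm_sub_le_of_hasDerivAt_coord {f g : ℝ → Wiener} {s : Set ℝ} (hs : Convex ℝ s)
    (h : ∀ τ ∈ s, ∀ n, HasDerivAt (fun σ => f σ n) (g τ n) τ) {C : ℝ} (hC : ∀ τ ∈ s, ‖g τ‖ ≤ C)
    {x y : ℝ} (hx : x ∈ s) (hy : y ∈ s) : ‖f y - f x‖ ≤ C * ‖y - x‖ := by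
  have hnorm : ∀ (z : Wiener) (S : Finset ℕ),
      ‖∑ n ∈ S, lp.single 1 n (z n)‖ = ∑ n ∈ S, ‖z n‖ := fun z S => by
    simpa using lp.norm_sum_single (E := fun _ : ℕ => ℂ) (p := 1) (by simp) z S
  rw [norm_wiener_le_iff]
  intro S
  rw [← hnorm]
  have hd : ∀ τ ∈ s, HasDerivWithinAt (fun σ => ∑ n ∈ S, lp.single 1 n (f σ n))
      (∑ n ∈ S, lp.single 1 n (g τ n) : Wiener) s τ := fun τ hτ =>
    HasDerivWithinAt.fun_sum fun n _ => ((lp.singleContinuousLinearMap ℝ (fun _ : ℕ => ℂ) 1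
      n).hasFDerivAt.comp_hasDerivAt τ (h τ hτ n)).hasDerivWithinAt
  have h1 := hs.norm_image_sub_le_of_norm_hasDerivWithin_le (C := C) hd (fun τ hτ => by
    rw [hnorm]
    exact norm_wiener_le_iff.1 (hC τ hτ) S) hx hy
  rw [← Finset.sum_sub_distrib] at h1
  simp only [← lp.single_sub] at h1
  exact h1

/-- A path in the Wiener algebra which is differentiable coefficientwise is differentiable if the
candidate derivative is continuous. -/
lemma hasDerivAt_of_coord {f g : ℝ → Wiener} {t : ℝ}
    (h : ∀ᶠ τ in 𝓝 t, ∀ n, HasDerivAt (fun σ => f σ n) (g τ n) τ) (hg : ContinuousAt g t) :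
    HasDerivAt f (g t) t := by
  rw [hasDerivAt_iff_isLittleO, Asymptotics.isLittleO_iff]
  intro c hc
  have h1 : ∀ᶠ τ in 𝓝 t, ‖g τ - g t‖ ≤ c := by
    filter_upwards [hg (closedBall_mem_nhds (g t) hc)] with τ hτ
    rwa [← dist_eq_norm]
  obtain ⟨r, hr, hball⟩ := Metric.eventually_nhds_iff_ball.1 (h.and h1)
  filter_upwards [ball_mem_nhds t hr] with τ hτ
  have h2 := norm_sub_le_of_hasDerivAt_coord (f := fun σ => f σ - (σ - t) • g t)
    (g := fun σ => g σ - g t) (convex_ball t r) (fun σ hσ n => ?_) (fun σ hσ => (hball σ hσ).2)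
    (mem_ball_self hr) hτ
  · simpa [sub_right_comm] using h2
  · refine (((hball σ hσ).1 n).sub (((hasDerivAt_id σ).sub_const t).smul_const (g t n))).congr_deriv
      ?_
    simp

/-- Paths in the Wiener algebra which solve the Szegő equation coefficientwise, together with the
evolutions generated by their Lax operators. -/
structure LaxFlow (w : ℝ → Wiener) (P Q V Y : ℝ → Op 2) : Prop where
  coord : ∀ t n, HasDerivAt (fun τ => w τ n) (vectorField (w t) n) t
  derivP : ∀ t, HasDerivAt P (laxOpB (w t) * P t) t
  derivV : ∀ t, HasDerivAt V (laxOpC (w t) * V t) t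
  mulPQ : ∀ t, P t * Q t = 1
  mulQP : ∀ t, Q t * P t = 1
  mulVY : ∀ t, V t * Y t = 1
  mulYV : ∀ t, Y t * V t = 1

/-- The path `w` is bounded near `t`. -/
def BddNear (w : ℝ → Wiener) (t : ℝ) : Prop := ∃ M, ∀ᶠ τ in 𝓝 t, ‖w τ‖ ≤ M

lemma isOpen_setOf_bddNear (w : ℝ → Wiener) : IsOpen {t | BddNear w t} := by
  simp only [BddNear, ofPred_exists]
  exact isOpen_iUnion fun M => isOpen_setOfPred_eventually_nhds

namespace LaxFlow

variable {w : ℝ → Wiener} {P Q V Y : ℝ → Op 2}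

lemma hasDerivAt (h : LaxFlow w P Q V Y) {t : ℝ} (ht : BddNear w t) :
    HasDerivAt w (vectorField (w t)) t := by
  obtain ⟨M, hM⟩ := ht
  obtain ⟨r, hr, hball⟩ := Metric.eventually_nhds_iff_ball.1 hM
  have hid : BddLip {x : Wiener | ‖x‖ ≤ M} (id : Wiener → Wiener) := bddLip_id fun x hx => hx
  obtain ⟨C, hC0, hC, hL⟩ := bddLip_vectorField hid
  have hlip : ∀ τ ∈ ball t r, ‖w τ - w t‖ ≤ C * ‖τ - t‖ := fun τ hτ =>
    norm_sub_le_of_hasDerivAt_coord (g := fun σ => vectorField (w σ)) (convex_ball t r)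
      (fun σ _ n => h.coord σ n) (fun σ hσ => hC _ (hball σ hσ)) (mem_ball_self hr) hτ
  refine hasDerivAt_of_coord (g := fun σ => vectorField (w σ))
    (Eventually.of_forall fun σ n => h.coord σ n) ?_
  rw [ContinuousAt, tendsto_iff_norm_sub_tendsto_zero]
  refine squeeze_zero' (Eventually.of_forall fun _ => norm_nonneg _)
    (g := fun τ => C * (C * ‖τ - t‖)) ?_ ?_
  · filter_upwards [ball_mem_nhds t hr] with τ hτ
    exact (hL _ (hball τ hτ) _ (hball t (mem_ball_self hr))).trans
      (mul_le_mul_of_nonneg_left (hlip τ hτ) hC0)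
  · have : Continuous fun τ : ℝ => C * (C * ‖τ - t‖) := by fun_prop
    simpa using this.tendsto t

lemma continuous_inv {P Q B : ℝ → Op 2} (h1 : ∀ t, P t * Q t = 1) (h2 : ∀ t, Q t * P t = 1)
    (hP : ∀ t, HasDerivAt P (B t * P t) t) : Continuous Q := by
  refine continuous_iff_continuousAt.2 fun t => ?_
  have := (hasDerivWithinAt_inv (B := B) (s := univ) (fun τ _ => h1 τ) (fun τ _ => h2 τ)
    (mem_univ t) (hP t).hasDerivWithinAt)
  exact (this.hasDerivAt univ_mem).continuousAt

end LaxFlow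

/-- If `A` is constant in the moving frame on a segment except at its endpoint `a`, then it is
constant on the whole segment, when `A` is continuous in a weak sense. -/
lemma conj_eq_of_lax_of_ne {a t : ℝ} {P Q B A : ℝ → Op 2} (hPQ : ∀ τ, P τ * Q τ = 1)
    (hQP : ∀ τ, Q τ * P τ = 1) (hP : ∀ τ, HasDerivAt P (B τ * P τ) τ)
    (hA : ∀ τ ∈ uIcc a t, τ ≠ a → HasDerivAt A (B τ * A τ - A τ * B τ) τ)
    (hcont : ∀ (k : ℕ) (c : ℂ) (n : ℕ), Continuous fun τ => A τ (lp.single 2 k c) n) :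
    Q t * A t * P t = Q a * A a * P a := by
  rcases eq_or_ne t a with rfl | hta
  · rfl
  set D := Q t * A t * P t with hD
  have hseg : ∀ τ ∈ uIcc a t, τ ≠ a → A τ = P τ * D * Q τ := by
    intro τ hτ hτa
    have hsub : uIcc τ t ⊆ uIcc a t := uIcc_subset_uIcc hτ right_mem_uIcc
    have hne : ∀ σ ∈ uIcc τ t, σ ≠ a := by
      rintro σ hσ rfl
      rcases le_total σ t with hle | hle
      · rw [uIcc_of_le hle] at hτ
        rw [uIcc_of_le hτ.2] at hσ
        exact hτa (le_antisymm hσ.1 hτ.1)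
      · rw [uIcc_of_ge hle] at hτ
        rw [uIcc_of_ge hτ.1] at hσ
        exact hτa (le_antisymm hτ.2 hσ.2)
    have h1 := conj_eq_of_lax (a := τ) (t := t) (B := B) (fun σ _ => hPQ σ) (fun σ _ => hQP σ)
      (fun σ _ => (hP σ).hasDerivWithinAt)
      (fun σ hσ => (hA σ (hsub hσ) (hne σ hσ)).hasDerivWithinAt)
    rw [hD, h1]
    linear_combination (norm := noncomm_ring) -(hPQ τ * A τ * P τ * Q τ) - A τ * hPQ τ
  have hQc := LaxFlow.continuous_inv hPQ hQP hP
  have hPc : Continuous P := continuous_iff_continuousAt.2 fun σ => (hP σ).continuousAt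
  have hmem : uIcc a t \ {a} ∈ 𝓝[uIcc a t \ {a}] a := self_mem_nhdsWithin
  have hnebot : (𝓝[uIcc a t \ {a}] a).NeBot := by
    rw [← mem_closure_iff_nhdsWithin_neBot]
    rcases lt_or_gt_of_ne hta with hlt | hlt
    · rw [uIcc_of_ge hlt.le, Icc_sdiff_right, closure_Ico hlt.ne]
      exact right_mem_Icc.2 hlt.le
    · rw [uIcc_of_le hlt.le, Icc_sdiff_left, closure_Ioc hlt.ne]
      exact left_mem_Icc.2 hlt.le
  have hAa : A a = P a * D * Q a := by
    ext1 x
    refine eq_of_single (f := A a) (g := (P a * D * Q a)) (by fun_prop) (by fun_prop)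
      (by simp) (by simp) (fun k c => ?_) x
    ext n
    have hc : Continuous fun τ => coord n ((P τ * D * Q τ) (lp.single 2 k c)) := by fun_prop
    have l1 := ((hcont k c n).tendsto a).mono_left (nhdsWithin_le_nhds (s := uIcc a t \ {a}))
    have l2 := (hc.tendsto a).mono_left (nhdsWithin_le_nhds (s := uIcc a t \ {a}))
    refine tendsto_nhds_unique (l1.congr' ?_) l2
    filter_upwards [hmem] with τ hτ
    rw [hseg τ hτ.1 hτ.2]
    rfl
  rw [hAa]
  linear_combination (norm := noncomm_ring) -(hQP a * D * Q a * P a) - D * hQP a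

lemma hankelOp_single_coord (u : Wiener) (k : ℕ) (c : ℂ) (n : ℕ) :
    (hankelOp u : Op 2) (lp.single 2 k c) n = u (n + k) * conj c := by
  rw [hankelOp_coord, hankel, tsum_eq_single k]
  · simp
  · intro m hm
    rw [lp.single_apply_ne _ _ _ hm, map_zero, mul_zero]

namespace LaxFlow

variable {w : ℝ → Wiener} {P Q V Y : ℝ → Op 2}

lemma continuous_coord (h : LaxFlow w P Q V Y) (n : ℕ) : Continuous fun t => w t n :=
  continuous_iff_continuousAt.2 fun t => (h.coord t n).continuousAt

lemma conjH (h : LaxFlow w P Q V Y) {a t : ℝ} (hb : ∀ τ ∈ uIcc a t, τ ≠ a → BddNear w τ) :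
    Q t * hankelOp (w t) * P t = Q a * hankelOp (w a) * P a := by
  refine conj_eq_of_lax_of_ne (A := fun τ => hankelOp (w τ)) h.mulPQ h.mulQP h.derivP
    (fun τ hτ hne => ?_) fun k c n => ?_
  · rw [← hankelOp_vectorField]
    exact hankelOp.hasFDerivAt.comp_hasDerivAt τ (h.hasDerivAt (hb τ hτ hne))
  · simp only [hankelOp_single_coord]
    exact (h.continuous_coord _).mul continuous_const

lemma conjK (h : LaxFlow w P Q V Y) {a t : ℝ} (hb : ∀ τ ∈ uIcc a t, τ ≠ a → BddNear w τ) :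
    Y t * shiftedHankelOp (w t) * V t = Y a * shiftedHankelOp (w a) * V a := by
  refine conj_eq_of_lax_of_ne (A := fun τ => shiftedHankelOp (w τ)) h.mulVY h.mulYV h.derivV
    (fun τ hτ hne => ?_) fun k c n => ?_
  · rw [← shiftedHankelOp_vectorField]
    exact shiftedHankelOp.hasFDerivAt.comp_hasDerivAt τ (h.hasDerivAt (hb τ hτ hne))
  · simp only [shiftedHankelOp_eq, mul_apply_eq_comp, backPow_apply, hankelOp_single_coord]
    exact (h.continuous_coord _).mul continuous_const

lemma laxFrame (h : LaxFlow w P Q V Y) {a t : ℝ} (hb : ∀ τ ∈ uIcc a t, τ ≠ a → BddNear w τ) :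
    LaxFrame a t w (fun τ => P τ * Q a) (fun τ => P a * Q τ) (fun τ => V τ * Y a)
      (fun τ => V a * Y τ) := by
  have hb' : ∀ τ ∈ uIcc a t, ∀ σ ∈ uIcc a τ, σ ≠ a → BddNear w σ := fun τ hτ σ hσ =>
    hb σ (uIcc_subset_uIcc left_mem_uIcc hτ hσ)
  refine ⟨fun τ _ => ?_, fun τ _ => ?_, fun τ _ => ?_, fun τ _ => ?_, fun τ _ => ?_,
    fun τ _ => ?_, h.mulPQ a, h.mulVY a, fun τ hτ => ?_, fun τ hτ => ?_⟩
  · rw [← mul_assoc]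
    exact ((h.derivP τ).mul_const _).hasDerivWithinAt
  · rw [← mul_assoc]
    exact ((h.derivV τ).mul_const _).hasDerivWithinAt
  · linear_combination (norm := noncomm_ring) P τ * h.mulQP a * Q τ + h.mulPQ τ
  · linear_combination (norm := noncomm_ring) P a * h.mulQP τ * Q a + h.mulPQ a
  · linear_combination (norm := noncomm_ring) V τ * h.mulYV a * Y τ + h.mulVY τ
  · linear_combination (norm := noncomm_ring) V a * h.mulYV τ * Y a + h.mulVY a
  · linear_combination (norm := noncomm_ring) P τ * h.conjH (hb' τ hτ) * Q τ
      - h.mulPQ τ * hankelOp (w τ) * P τ * Q τ - hankelOp (w τ) * h.mulPQ τ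
  · linear_combination (norm := noncomm_ring) V τ * h.conjK (hb' τ hτ) * Y τ
      - h.mulVY τ * shiftedHankelOp (w τ) * V τ * Y τ - shiftedHankelOp (w τ) * h.mulVY τ

/-- The path is bounded near every time. -/
theorem bddNear (h : LaxFlow w P Q V Y) (t : ℝ) : BddNear w t := by
  by_contra ht
  set F : Set ℝ := {t | BddNear w t}ᶜ with hF
  have hFc : IsClosed F := (isOpen_setOf_bddNear w).isClosed_compl
  have : Nonempty F := ⟨⟨t, ht⟩⟩
  have : CompleteSpace F := hFc.completeSpace_coe
  obtain ⟨k, ⟨c, hcF⟩, hc⟩ := nonempty_interior_of_iUnion_of_closed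
    (f := fun k : ℕ => {x : F | ‖w x‖ ≤ k})
    (fun k => isClosed_norm_wiener_le
      (fun n => (h.continuous_coord n).comp continuous_subtype_val) k)
    (eq_univ_of_forall fun x => mem_iUnion.2 (exists_nat_ge ‖w x‖))
  obtain ⟨r, hr, hball⟩ := Metric.mem_nhds_iff.1 (mem_interior_iff_mem_nhds.1 hc)
  have hk : ∀ x ∈ F, |x - c| < r → ‖w x‖ ≤ k := fun x hx hxr =>
    hball (show (⟨x, hx⟩ : F) ∈ ball _ r from hxr)
  obtain ⟨δ, hδ, hex⟩ := exists_laxFrame (k := k) (Nat.cast_nonneg k)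
  refine hcF ⟨k + 1, ?_⟩
  filter_upwards [ball_mem_nhds c (lt_min hr hδ)] with t ht
  rw [mem_ball, Real.dist_eq, lt_min_iff] at ht
  obtain ⟨a, ⟨hau, haF⟩, hmin⟩ := (isCompact_uIcc.inter_right hFc).exists_isMinOn
    (f := fun x : ℝ => |t - x|) ⟨c, (left_mem_uIcc : c ∈ uIcc c t), hcF⟩ (by fun_prop)
  have hat : |t - a| ≤ |t - c| := hmin ⟨left_mem_uIcc, hcF⟩
  have hac : |a - c| ≤ |t - c| := abs_sub_left_of_mem_uIcc hau
  have hb : ∀ τ ∈ uIcc a t, τ ≠ a → BddNear w τ := by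
    intro τ hτ hne
    by_contra hτF
    have h1 : |t - a| ≤ |t - τ| := hmin ⟨uIcc_subset_uIcc hau right_mem_uIcc hτ, hτF⟩
    rcases le_total a t with hle | hle
    · rw [uIcc_of_le hle] at hτ
      rw [abs_of_nonneg (by linarith), abs_of_nonneg (by linarith [hτ.2])] at h1
      exact hne (le_antisymm (by linarith) hτ.1)
    · rw [uIcc_of_ge hle] at hτ
      rw [abs_of_nonpos (by linarith), abs_of_nonpos (by linarith [hτ.1])] at h1
      exact hne (le_antisymm hτ.2 (by linarith))
  obtain ⟨w', P', Q', V', Y', hw', hframe, hbound⟩ := hex (w a) (hk a haF (by linarith)) a t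
    (by linarith)
  rwa [(h.laxFrame hb).unique hframe hw'.symm]

end LaxFlow

end Szego

namespace Szego

open scoped ENNReal NNReal Topology
open Filter Set

lemma summable_norm_of_inHs {s : ℝ} (hs : 1 / 2 < s) {c : ℕ → ℂ} (hc : InHs s c) :
    Summable fun k => ‖c k‖ := by
  have h1 : Summable fun k : ℕ => ((1 : ℝ) + (k : ℝ) ^ 2) ^ (-s) := by
    rw [← summable_nat_add_iff 1]
    refine Summable.of_nonneg_of_le (fun k => by positivity) (fun k => ?_)
      ((summable_nat_add_iff 1).2 (Real.summable_nat_rpow (p := -(2 * s)).2 (by linarith)))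
    have hk : (0 : ℝ) < ((k + 1 : ℕ) : ℝ) := by positivity
    have h2 : ((k + 1 : ℕ) : ℝ) ^ (-(2 * s)) = (((k + 1 : ℕ) : ℝ) ^ 2) ^ (-s) := by
      rw [← Real.rpow_natCast_mul hk.le]
      congr 1
      push_cast
      ring
    rw [h2]
    exact Real.rpow_le_rpow_of_nonpos (by positivity) (by linarith) (by linarith)
  refine Summable.of_nonneg_of_le (fun k => norm_nonneg _) (fun k => ?_) (hc.add h1)
  set x : ℝ := (1 : ℝ) + (k : ℝ) ^ 2 with hx
  have hx0 : 0 < x := by positivity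
  have h3 : x ^ s * x ^ (-s) = 1 := by
    rw [← Real.rpow_add hx0, add_neg_cancel, Real.rpow_zero]
  have h4 : 0 < x ^ s := Real.rpow_pos_of_pos hx0 s
  have h5 : x ^ (-s) * (x ^ s * ‖c k‖ - 1) ^ 2 = x ^ s * ‖c k‖ ^ 2 + x ^ (-s) - 2 * ‖c k‖ := by
    linear_combination (x ^ s * ‖c k‖ ^ 2 - 2 * ‖c k‖) * h3
  have h6 : 0 ≤ x ^ (-s) * (x ^ s * ‖c k‖ - 1) ^ 2 := by positivity
  linarith [norm_nonneg (c k)]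

/-- An absolutely summable sequence, as an element of the Wiener algebra. -/
def wienerMk (c : ℕ → ℂ) (hc : Summable fun k => ‖c k‖) : Wiener :=
  ⟨c, memℓp_gen (by simpa using hc)⟩

section Unitary

variable {E : Type*} [NormedAddCommGroup E] [InnerProductSpace ℂ E] [CompleteSpace E]
  {B U : ℝ → E →L[ℂ] E}

/-- The solution of `U' = BU`, `U(0) = 1` is isometric if `B` is skew-adjoint. -/
lemma adjoint_mul_self_of_hasDerivAt (hB : ∀ t x y, inner ℂ (B t x) y = -inner ℂ x (B t y))
    (hU : ∀ t, HasDerivAt U (B t ∘L U t) t) (hU0 : U 0 = 1) (t : ℝ) :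
    ContinuousLinearMap.adjoint (U t) ∘L U t = 1 := by
  ext x
  refine ext_inner_left ℂ fun y => ?_
  have hd : ∀ (x : E) (τ : ℝ), HasDerivAt (fun σ => U σ x) (B τ (U τ x)) τ := fun x τ =>
    (((ContinuousLinearMap.apply ℂ E x).restrictScalars ℝ).hasFDerivAt.comp_hasDerivAt τ (hU τ):)
  have h1 : inner ℂ (U t y) (U t x) = inner ℂ (U 0 y) (U 0 x) := by
    refine eq_of_hasDerivWithinAt_zero (f := fun σ => inner ℂ (U σ y) (U σ x)) fun τ _ => ?_
    refine (((hd y τ).inner ℂ (hd x τ)).congr_deriv ?_).hasDerivWithinAt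
    rw [hB, add_neg_cancel]
  rw [ContinuousLinearMap.comp_apply, ContinuousLinearMap.adjoint_inner_right, h1, hU0]
  rfl

/-- The solution of `U' = BU`, `U(0) = 1` is unitary if `B` is skew-adjoint. -/
lemma self_mul_adjoint_of_hasDerivAt (hB : ∀ t x y, inner ℂ (B t x) y = -inner ℂ x (B t y))
    (hU : ∀ t, HasDerivAt U (B t ∘L U t) t) (hU0 : U 0 = 1) (t : ℝ) :
    U t ∘L ContinuousLinearMap.adjoint (U t) = 1 := by
  have hc : Continuous U := continuous_iff_continuousAt.2 fun τ => (hU τ).continuousAt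
  have hiff : ∀ τ, IsUnit (U τ) ↔ U τ ∘L ContinuousLinearMap.adjoint (U τ) = 1 := by
    intro τ
    have h1 : ContinuousLinearMap.adjoint (U τ) * U τ = 1 :=
      adjoint_mul_self_of_hasDerivAt hB hU hU0 τ
    refine ⟨fun h => ?_, fun h => ⟨⟨U τ, ContinuousLinearMap.adjoint (U τ), h, h1⟩, rfl⟩⟩
    obtain ⟨v, hv⟩ := h
    rw [← hv] at h1 ⊢
    rw [Units.eq_inv_of_mul_eq_one_right h1]
    exact v.mul_inv
  have hopen : IsOpen {τ | IsUnit (U τ)} := Units.isOpen.preimage hc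
  have hclosed : IsClosed {τ | IsUnit (U τ)} := by
    simp only [hiff]
    exact isClosed_eq (hc.clm_comp (ContinuousLinearMap.adjoint.continuous.comp hc))
      continuous_const
  have huniv := IsClopen.eq_univ ⟨hclosed, hopen⟩ ⟨0, by simp [hU0]⟩
  exact (hiff t).1 (huniv.ge (mem_univ t))

end Unitary

lemma hasDerivAt_restrictScalars {B U : ℝ → Hardy →L[ℂ] Hardy} {t : ℝ}
    (hU : HasDerivAt U (B t ∘L U t) t) :
    HasDerivAt (fun τ => ((U τ).restrictScalars ℝ : Op 2))
      ((B t).restrictScalars ℝ * (U t).restrictScalars ℝ) t :=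
  ((ContinuousLinearMap.restrictScalarsL ℂ Hardy Hardy ℝ ℝ).hasFDerivAt.comp_hasDerivAt t hU :)

lemma restrictScalars_mul_eq_one {A B : Hardy →L[ℂ] Hardy} (h : A ∘L B = 1) :
    (A.restrictScalars ℝ * B.restrictScalars ℝ : Op 2) = 1 := by
  ext1 x
  exact DFunLike.congr_fun h x

lemma apply_eq_of_conj {A A₀ : Op 2} {W : Hardy →L[ℂ] Hardy}
    (hW : W ∘L ContinuousLinearMap.adjoint W = 1)
    (h : (ContinuousLinearMap.adjoint W).restrictScalars ℝ * A * W.restrictScalars ℝ = A₀)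
    (x : Hardy) : A x = W (A₀ (ContinuousLinearMap.adjoint W x)) := by
  have h1 := restrictScalars_mul_eq_one hW
  have h2 : A = W.restrictScalars ℝ * A₀ * (ContinuousLinearMap.adjoint W).restrictScalars ℝ := by
    rw [← h]
    linear_combination (norm := noncomm_ring) -(h1 * A * W.restrictScalars ℝ
      * (ContinuousLinearMap.adjoint W).restrictScalars ℝ) - A * h1
  exact DFunLike.congr_fun h2 x

lemma laxOpB_coord (u : Wiener) (h : Hardy) (n : ℕ) : laxOpB u h n = laxB u h n := by
  simp only [laxOpB, laxB, mul_apply_eq_comp, mulI_apply, lp.coeFn_smul, Pi.smul_apply, sub_apply,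
    smul_apply, lp.coeFn_sub, Pi.sub_apply, hankelOp_coord, toepOp, smul_eq_mul, Complex.real_smul]
  rw [← mul_apply_eq_comp, toeplitz_coord,
    show ((hankelOp u : Op 2) h : ℕ → ℂ) = hankel u h from funext fun m => hankelOp_coord u h m]
  push_cast
  ring

lemma shiftedHankelOp_coord (u : Wiener) (h : Hardy) (n : ℕ) :
    shiftedHankelOp u h n = shiftedHankel u h n := by
  rw [shiftedHankelOp_eq, mul_apply_eq_comp, backPow_apply, hankelOp_coord, shiftedHankel]

lemma laxOpC_coord (u : Wiener) (h : Hardy) (n : ℕ) : laxOpC u h n = laxC u h n := by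
  simp only [laxOpC, laxC, mul_apply_eq_comp, mulI_apply, lp.coeFn_smul, Pi.smul_apply, sub_apply,
    smul_apply, lp.coeFn_sub, Pi.sub_apply, shiftedHankelOp_coord, toepOp, smul_eq_mul,
    Complex.real_smul]
  rw [← mul_apply_eq_comp, toeplitz_coord,
    show ((shiftedHankelOp u : Op 2) h : ℕ → ℂ) = shiftedHankel u h from
      funext fun m => shiftedHankelOp_coord u h m]
  push_cast
  ring

lemma vectorField_coord (u : Wiener) (n : ℕ) :
    vectorField u n = -Complex.I * szegoNL u n := by
  rw [szegoNL, ← toeplitz_coord (p := 1) u u u n, mul_apply_eq_comp, neg_mul]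
  rfl

end Szego

/-- **Corollary 2.3**: the solutions `U(t), V(t)` of `U' = B_u U`, `V' = C_u V`, `U(0)=V(0)=I`
are unitary and conjugate `H_{u(t)}, K_{u(t)}` to `H_{u(0)}, K_{u(0)}` (the operator identities
`H_{u(t)} = U(t) H_{u(0)} U(t)*`, `K_{u(t)} = V(t) K_{u(0)} V(t)*` being expressed
coefficientwise, through an auxiliary vector `v` realizing `H_{u(0)}(U(t)* h)`). -/
theorem statement7 (s : ℝ) (hs : 1 / 2 < s) (u : ℝ → Hardy) (hsol : IsSzegoSolution s u)
    (Bop Cop U V : ℝ → Hardy →L[ℂ] Hardy)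
    (hB : ∀ (t : ℝ) (h : Hardy) (n : ℕ), coeffs (Bop t h) n = laxB (coeffs (u t)) (coeffs h) n)
    (hC : ∀ (t : ℝ) (h : Hardy) (n : ℕ), coeffs (Cop t h) n = laxC (coeffs (u t)) (coeffs h) n)
    (hU : ∀ t : ℝ, HasDerivAt U (Bop t ∘L U t) t) (hU0 : U 0 = 1)
    (hV : ∀ t : ℝ, HasDerivAt V (Cop t ∘L V t) t) (hV0 : V 0 = 1)
    (t : ℝ) :
    (U t ∘L ContinuousLinearMap.adjoint (U t) = 1 ∧
      ContinuousLinearMap.adjoint (U t) ∘L U t = 1) ∧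
    (V t ∘L ContinuousLinearMap.adjoint (V t) = 1 ∧
      ContinuousLinearMap.adjoint (V t) ∘L V t = 1) ∧
    (∀ h v : Hardy,
      (∀ n, coeffs v n
          = hankel (coeffs (u 0)) (coeffs (ContinuousLinearMap.adjoint (U t) h)) n) →
      ∀ n, hankel (coeffs (u t)) (coeffs h) n = coeffs (U t v) n) ∧
    (∀ h v : Hardy,
      (∀ n, coeffs v n
          = shiftedHankel (coeffs (u 0)) (coeffs (ContinuousLinearMap.adjoint (V t) h)) n) →
      ∀ n, shiftedHankel (coeffs (u t)) (coeffs h) n = coeffs (V t v) n) := by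
  obtain ⟨hHs, -, hder⟩ := hsol
  set w : ℝ → Szego.Wiener := fun τ =>
    Szego.wienerMk (coeffs (u τ)) (Szego.summable_norm_of_inHs hs (hHs τ)) with hw
  have hBw : ∀ τ, (Bop τ).restrictScalars ℝ = Szego.laxOpB (w τ) := fun τ => by
    ext h n
    exact (hB τ h n).trans (Szego.laxOpB_coord (w τ) h n).symm
  have hCw : ∀ τ, (Cop τ).restrictScalars ℝ = Szego.laxOpC (w τ) := fun τ => by
    ext h n
    exact (hC τ h n).trans (Szego.laxOpC_coord (w τ) h n).symm
  have hBskew : ∀ τ x y, inner ℂ (Bop τ x) y = -inner ℂ x (Bop τ y) := fun τ x y => by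
    have h := Szego.inner_laxOpB (w τ) x y
    rwa [← hBw] at h
  have hCskew : ∀ τ x y, inner ℂ (Cop τ x) y = -inner ℂ x (Cop τ y) := fun τ x y => by
    have h := Szego.inner_laxOpC (w τ) x y
    rwa [← hCw] at h
  have hUU := Szego.self_mul_adjoint_of_hasDerivAt hBskew hU hU0
  have hUU' := Szego.adjoint_mul_self_of_hasDerivAt hBskew hU hU0
  have hVV := Szego.self_mul_adjoint_of_hasDerivAt hCskew hV hV0
  have hVV' := Szego.adjoint_mul_self_of_hasDerivAt hCskew hV hV0
  have hflow : Szego.LaxFlow w (fun τ => (U τ).restrictScalars ℝ)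
      (fun τ => (ContinuousLinearMap.adjoint (U τ)).restrictScalars ℝ)
      (fun τ => (V τ).restrictScalars ℝ)
      (fun τ => (ContinuousLinearMap.adjoint (V τ)).restrictScalars ℝ) := by
    refine ⟨fun τ n => ?_, fun τ => ?_, fun τ => ?_,
      fun τ => Szego.restrictScalars_mul_eq_one (hUU τ),
      fun τ => Szego.restrictScalars_mul_eq_one (hUU' τ),
      fun τ => Szego.restrictScalars_mul_eq_one (hVV τ),
      fun τ => Szego.restrictScalars_mul_eq_one (hVV' τ)⟩
    · rw [Szego.vectorField_coord]
      exact hder τ n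
    · rw [← hBw]
      exact Szego.hasDerivAt_restrictScalars (hU τ)
    · rw [← hCw]
      exact Szego.hasDerivAt_restrictScalars (hV τ)
  have hb := hflow.bddNear
  have hH := hflow.conjH (a := 0) (t := t) fun τ _ _ => hb τ
  have hK := hflow.conjK (a := 0) (t := t) fun τ _ _ => hb τ
  have hadj : ContinuousLinearMap.adjoint (1 : Hardy →L[ℂ] Hardy) = 1 :=
    ContinuousLinearMap.adjoint_one
  have hone : ((1 : Hardy →L[ℂ] Hardy).restrictScalars ℝ : Szego.Op 2) = 1 := rfl
  simp only [hU0, hadj, hone, one_mul, mul_one] at hH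
  simp only [hV0, hadj, hone, one_mul, mul_one] at hK
  refine ⟨⟨hUU t, hUU' t⟩, ⟨hVV t, hVV' t⟩, fun h v hv n => ?_, fun h v hv n => ?_⟩
  · have hv' : v = Szego.hankelOp (w 0) (ContinuousLinearMap.adjoint (U t) h) := by
      ext m
      exact (hv m).trans (Szego.hankelOp_coord (w 0) _ m).symm
    rw [hv', ← Szego.apply_eq_of_conj (hUU t) hH h]
    exact (Szego.hankelOp_coord (w t) h n).symm
  · have hv' : v = Szego.shiftedHankelOp (w 0) (ContinuousLinearMap.adjoint (V t) h) := by
      ext m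
      exact (hv m).trans (Szego.shiftedHankelOp_coord (w 0) _ m).symm
    rw [hv', ← Szego.apply_eq_of_conj (hVV t) hK h]
    exact (Szego.shiftedHankelOp_coord (w t) h n).symm

end
end

section
/- Let ε be a nonzero real number and u₀^ε(x) = e^{ix} + ε. The solution u^ε of the cubic Szegő equation i∂_t u = Π(|u|²u) with u(0) = u₀^ε is given by u^ε(t,x) = (a^ε(t)e^{ix} + b^ε(t))/(1 − p^ε(t)e^{ix}), where, setting ω := (ε/2)√(4+ε²): a^ε(t) = e^{−it(1+ε²)}, b^ε(t) = e^{−it(1+ε²/2)}( ε cos(ωt) − i((2+ε²)/√(4+ε²)) sin(ωt) ), and p^ε(t) = −(2i/√(4+ε²)) sin(ωt) e^{−itε²/2}. -/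
open scoped BigOperators ComplexConjugate

noncomputable section

/-- The frequency `ω = (ε/2)√(4+ε²)`. -/
def szOmega (ε : ℝ) : ℝ := ε / 2 * Real.sqrt (4 + ε ^ 2)

/-- `a^ε(t) = e^{-it(1+ε²)}`. -/
def szA (ε t : ℝ) : ℂ := Complex.exp (-(Complex.I * t * (1 + ε ^ 2)))

/-- `b^ε(t) = e^{-it(1+ε²/2)} (ε cos(ωt) - i ((2+ε²)/√(4+ε²)) sin(ωt))`. -/
def szB (ε t : ℝ) : ℂ :=
  Complex.exp (-(Complex.I * t * (1 + ε ^ 2 / 2))) *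
    (ε * Real.cos (szOmega ε * t)
      - Complex.I * ((2 + ε ^ 2) / Real.sqrt (4 + ε ^ 2)) * Real.sin (szOmega ε * t))

/-- `p^ε(t) = -(2i/√(4+ε²)) sin(ωt) e^{-itε²/2}`. -/
def szP (ε t : ℝ) : ℂ :=
  -(2 * Complex.I / Real.sqrt (4 + ε ^ 2)) * Real.sin (szOmega ε * t) *
    Complex.exp (-(Complex.I * t * ε ^ 2 / 2))

open scoped InnerProductSpace

theorem Hardy.summable_sq (f : Hardy) : Summable fun n => ‖f n‖ ^ 2 := by
  have h := (memℓp_gen_iff (p := 2) (by norm_num)).1 (lp.memℓp f)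
  simpa using h

theorem Hardy.norm_sq_eq_tsum (f : Hardy) : ‖f‖ ^ 2 = ∑' n, ‖f n‖ ^ 2 := by
  have h := lp.norm_rpow_eq_tsum (p := 2) (by norm_num) f
  simpa using h

/-- The sequence obtained by shifting `f` to the right by `p`. -/
def shiftSeq (p : ℕ) (f : ℕ → ℂ) : ℕ → ℂ := fun n => if p ≤ n then f (n - p) else 0

theorem hasSum_norm_sq_shiftSeq (p : ℕ) (f : Hardy) :
    HasSum (fun n => ‖shiftSeq p f n‖ ^ 2) (‖f‖ ^ 2) := by
  have hinj : Function.Injective fun q : ℕ => q + p := add_left_injective p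
  rw [← hinj.hasSum_iff]
  · rw [Hardy.norm_sq_eq_tsum]
    simpa [Function.comp_def, shiftSeq] using (Hardy.summable_sq f).hasSum
  · intro n hn
    have : ¬ p ≤ n := fun h => hn ⟨n - p, by simp; omega⟩
    simp [shiftSeq, this]

/-- Multiplication by `e^{ipx}` on the Hardy space, as a linear isometry. -/
def shiftLI (p : ℕ) : Hardy →ₗᵢ[ℂ] Hardy where
  toFun f := ⟨shiftSeq p f, memℓp_gen (by
    simpa using (hasSum_norm_sq_shiftSeq p f).summable)⟩
  map_add' f g := by
    ext n
    change shiftSeq p (f + g : Hardy) n = shiftSeq p f n + shiftSeq p g n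
    by_cases h : p ≤ n <;> simp [shiftSeq, h]
  map_smul' c f := by
    ext n
    by_cases h : p ≤ n <;> simp [shiftSeq, h]
  norm_map' f := by
    rw [← sq_eq_sq₀ (norm_nonneg _) (norm_nonneg _), Hardy.norm_sq_eq_tsum]
    exact (hasSum_norm_sq_shiftSeq p f).tsum_eq

/-- Multiplication by `e^{ipx}` on the Hardy space, as a continuous linear map. -/
def shiftCLM (p : ℕ) : Hardy →L[ℂ] Hardy := (shiftLI p).toContinuousLinearMap

theorem norm_shiftCLM_le (p : ℕ) : ‖shiftCLM p‖ ≤ 1 := (shiftLI p).norm_toContinuousLinearMap_le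

/-- Multiplication by the function with Fourier coefficients `a` on the Hardy space. -/
def mulOp (a : ℕ → ℂ) : Hardy →L[ℂ] Hardy := ∑' p, a p • shiftCLM p

theorem norm_smul_shiftCLM_le (c : ℂ) (p : ℕ) : ‖c • shiftCLM p‖ ≤ ‖c‖ := by
  rw [norm_smul]
  exact mul_le_of_le_one_right (norm_nonneg _) (norm_shiftCLM_le p)

theorem summable_smul_shiftCLM {a : ℕ → ℂ} (ha : InW a) :
    Summable fun p => a p • shiftCLM p :=
  Summable.of_norm_bounded ha fun p => norm_smul_shiftCLM_le _ p

theorem norm_mulOp_le {a : ℕ → ℂ} (ha : InW a) : ‖mulOp a‖ ≤ wienerNorm a :=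
  tsum_of_norm_bounded ha.hasSum fun p => norm_smul_shiftCLM_le _ p

theorem norm_mulOp_apply_le {a : ℕ → ℂ} (ha : InW a) (f : Hardy) :
    ‖mulOp a f‖ ≤ wienerNorm a * ‖f‖ :=
  (mulOp a).le_of_opNorm_le (norm_mulOp_le ha) f

theorem mulOp_add {a b : ℕ → ℂ} (ha : InW a) (hb : InW b) :
    mulOp (a + b) = mulOp a + mulOp b := by
  unfold mulOp
  rw [← (summable_smul_shiftCLM ha).tsum_add (summable_smul_shiftCLM hb)]
  simp [add_smul]

theorem mulOp_apply {a : ℕ → ℂ} (ha : InW a) (f : Hardy) (n : ℕ) :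
    mulOp a f n = mulCoeff a f n := by
  have h := (summable_smul_shiftCLM ha).hasSum
  have h2 := ((lp.evalCLM ℂ (fun _ : ℕ => ℂ) 2 n).comp
    (ContinuousLinearMap.apply ℂ Hardy f)).hasSum h
  have h3 : HasSum (fun p => a p * if p ≤ n then f (n - p) else 0) (mulOp a f n) := h2
  rw [← h3.tsum_eq, tsum_eq_sum (s := Finset.range (n + 1))]
  · refine Finset.sum_congr rfl fun p hp => ?_
    rw [if_pos (by simpa [Nat.lt_succ_iff] using hp)]
  · intro p hp
    rw [if_neg (by simpa [Nat.lt_succ_iff] using hp), mul_zero]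

theorem mulCoeff_comm (f g : ℕ → ℂ) : mulCoeff f g = mulCoeff g f := by
  funext n
  unfold mulCoeff
  rw [← Finset.sum_range_reflect]
  refine Finset.sum_congr rfl fun p hp => ?_
  have : p ≤ n := by simpa [Nat.lt_succ_iff] using hp
  rw [mul_comm]
  rw [show n + 1 - 1 - p = n - p by omega, show n - (n - p) = p by omega]

theorem mulOp_comm {f g : Hardy} (hf : InW f) (hg : InW g) : mulOp f g = mulOp g f := by
  ext n
  rw [mulOp_apply hf, mulOp_apply hg, mulCoeff_comm]

theorem mulOp_single {a : ℕ → ℂ} (ha : InW a) (n m : ℕ) :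
    mulOp a (lp.single 2 n 1) m = if n ≤ m then a (m - n) else 0 := by
  rw [mulOp_apply ha, mulCoeff]
  split_ifs with h
  · rw [Finset.sum_eq_single (m - n)]
    · rw [show m - (m - n) = n by omega]
      simp
    · intro p hp hpn
      have : m - p ≠ n := by simp at hp; omega
      rw [lp.single_apply_ne _ _ _ this, mul_zero]
    · intro h
      simp at h
  · refine Finset.sum_eq_zero fun p hp => ?_
    have : m - p ≠ n := by omega
    rw [lp.single_apply_ne _ _ _ this, mul_zero]

theorem mulOp_single_zero {a : ℕ → ℂ} (ha : InW a) (n : ℕ) :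
    mulOp a (lp.single 2 0 1) n = a n := by
  simp [mulOp_single ha]

/-- The nonlinearity `Π(|f|²f) = T_{\bar f} (f²)` as an element of the Hardy space. -/
def nonlin (f : Hardy) : Hardy := ContinuousLinearMap.adjoint (mulOp f) (mulOp f f)

theorem inner_nonlin (f g : Hardy) : ⟪nonlin f, g⟫_ℂ = ⟪mulOp f f, mulOp f g⟫_ℂ :=
  ContinuousLinearMap.adjoint_inner_left _ _ _

theorem inner_nonlin_right (f g : Hardy) : ⟪g, nonlin f⟫_ℂ = ⟪mulOp f g, mulOp f f⟫_ℂ :=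
  ContinuousLinearMap.adjoint_inner_right _ _ _

theorem nonlin_apply {f : Hardy} (hf : InW f) (n : ℕ) : nonlin f n = szegoNL f n := by
  have h1 : nonlin f n = ⟪(lp.single 2 n 1 : Hardy), nonlin f⟫_ℂ := by
    rw [lp.inner_single_left]
    simp
  have hinj : Function.Injective fun q : ℕ => n + q := add_right_injective n
  rw [h1, inner_nonlin_right, lp.inner_eq_tsum, szegoNL, toeplitzAB, ← hinj.tsum_eq]
  · refine tsum_congr fun q => ?_
    rw [mulOp_single hf, mulOp_apply hf]
    simp [mul_comm]
  · intro m hm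
    have : n ≤ m := by
      by_contra h
      exact hm (by simp [mulOp_single hf, h])
    exact ⟨m - n, by simp; omega⟩

theorem norm_mulCoeff_self_le (w : Hardy) (n : ℕ) : ‖mulCoeff w w n‖ ≤ ‖w‖ ^ 2 := by
  have hs : ∑ p ∈ Finset.range (n + 1), ‖w p‖ ^ 2 ≤ ‖w‖ ^ 2 := by
    rw [Hardy.norm_sq_eq_tsum]
    exact (Hardy.summable_sq w).sum_le_tsum _ fun _ _ => by positivity
  have hr : ∑ p ∈ Finset.range (n + 1), ‖w (n - p)‖ ^ 2
      = ∑ p ∈ Finset.range (n + 1), ‖w p‖ ^ 2 := by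
    rw [← Finset.sum_range_reflect]
    refine Finset.sum_congr rfl fun p hp => ?_
    have : p ≤ n := by simpa [Nat.lt_succ_iff] using hp
    rw [show n + 1 - 1 - p = n - p by omega, show n - (n - p) = p by omega]
  calc ‖mulCoeff w w n‖ ≤ ∑ p ∈ Finset.range (n + 1), ‖w p * w (n - p)‖ := norm_sum_le _ _
    _ ≤ ∑ p ∈ Finset.range (n + 1), (‖w p‖ ^ 2 + ‖w (n - p)‖ ^ 2) / 2 := by
      refine Finset.sum_le_sum fun p _ => ?_
      rw [norm_mul]
      nlinarith [sq_nonneg (‖w p‖ - ‖w (n - p)‖)]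
    _ ≤ ‖w‖ ^ 2 := by
      rw [← Finset.sum_div, Finset.sum_add_distrib, hr]
      linarith

theorem norm_inner_mulOp_le {f g w : Hardy} (hf : InW f) (hg : InW g) (hw : InW w) :
    ‖⟪mulOp f g, mulOp w w⟫_ℂ‖ ≤ wienerNorm f * wienerNorm g * ‖w‖ ^ 2 := by
  have hf' : Summable fun n => ‖f n‖ := hf
  have hg' : Summable fun n => ‖g n‖ := hg
  have hs := hasSum_sum_range_mul_of_summable_norm (f := fun n => ‖f n‖) (g := fun n => ‖g n‖)
    (by simpa using hf') (by simpa using hg')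
  rw [lp.inner_eq_tsum]
  refine tsum_of_norm_bounded (hs.mul_right (‖w‖ ^ 2)) fun n => ?_
  rw [mulOp_apply hf, mulOp_apply hw, RCLike.inner_apply, norm_mul, RCLike.norm_conj, mul_comm]
  refine mul_le_mul ?_ (norm_mulCoeff_self_le w n) (norm_nonneg _) (by positivity)
  exact (norm_sum_le _ _).trans_eq (by simp)

theorem InHs.inW {u : ℕ → ℂ} (h : InHs 1 u) : InW u := by
  have h1 : Summable fun k : ℕ => 1 / ((1 : ℝ) + (k : ℝ) ^ 2) := by
    have h0 : Summable fun k : ℕ => 2 * (1 / ((k + 1 : ℕ) : ℝ) ^ 2) :=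
      ((summable_nat_add_iff 1).2 (Real.summable_one_div_nat_pow.2 one_lt_two)).mul_left 2
    refine Summable.of_nonneg_of_le (fun k => by positivity) (fun k => ?_) h0
    push_cast
    rw [mul_one_div, div_le_div_iff₀ (by positivity) (by positivity)]
    nlinarith [sq_nonneg ((k : ℝ) - 1)]
  refine Summable.of_nonneg_of_le (fun k => norm_nonneg _) (fun k => ?_) (h.add h1)
  have hk : (0 : ℝ) < 1 + (k : ℝ) ^ 2 := by positivity
  have h2 : (1 + (k : ℝ) ^ 2) * (1 / (1 + (k : ℝ) ^ 2)) = 1 := by field_simp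
  have h3 : 0 < 1 / (1 + (k : ℝ) ^ 2) := by positivity
  rw [Real.rpow_one]
  set c := 1 / (1 + (k : ℝ) ^ 2)
  have h4 : 0 ≤ c * ((1 + (k : ℝ) ^ 2) * ‖u k‖ - 1) ^ 2 := by positivity
  have h5 : c * ((1 + (k : ℝ) ^ 2) * ‖u k‖ - 1) ^ 2
      = (1 + (k : ℝ) ^ 2) * ‖u k‖ ^ 2 - 2 * ‖u k‖ + c := by
    linear_combination ((1 + (k : ℝ) ^ 2) * ‖u k‖ ^ 2 - 2 * ‖u k‖) * h2
  linarith [norm_nonneg (u k)]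

theorem mulOp_add_self {v w : Hardy} (hv : InW v) (hw : InW w) :
    mulOp (v + w : Hardy) (v + w) = mulOp v v + ((2 : ℝ) • mulOp v w + mulOp w w) := by
  rw [lp.coeFn_add, mulOp_add hv hw, add_apply, map_add, map_add, mulOp_comm hw hv, two_smul]
  abel

theorem InW.sub {a b : ℕ → ℂ} (ha : InW a) (hb : InW b) : InW (a - b) :=
  Summable.of_nonneg_of_le (fun _ => norm_nonneg _) (fun n => norm_sub_le (a n) (b n))
    (Summable.add ha hb)

theorem wienerNorm_nonneg (a : ℕ → ℂ) : 0 ≤ wienerNorm a := tsum_nonneg fun _ => norm_nonneg _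

theorem norm_sq_mulOp_add_self {v w : Hardy} (hv : InW v) (hw : InW w) :
    ‖mulOp (v + w : Hardy) (v + w)‖ ^ 2 = ‖mulOp v v‖ ^ 2 + 4 * (⟪nonlin v, w⟫_ℂ).re
      + 2 * (⟪mulOp v v, mulOp w w⟫_ℂ).re + ‖(2 : ℝ) • mulOp v w + mulOp w w‖ ^ 2 := by
  rw [mulOp_add_self hv hw, norm_add_sq (𝕜 := ℂ), inner_add_right, inner_nonlin, two_smul,
    inner_add_right]
  simp only [RCLike.re_to_complex, Complex.add_re]
  ring

theorem hasDerivAt_norm_sq {x : ℝ → Hardy} {x' : Hardy} {t : ℝ} (hx : HasDerivAt x x' t) :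
    HasDerivAt (fun τ => ‖x τ‖ ^ 2) (2 * (⟪x t, x'⟫_ℂ).re) t := by
  have h := Complex.reCLM.hasFDerivAt.comp_hasDerivAt t (hx.inner ℂ hx)
  have e : (fun τ => ‖x τ‖ ^ 2) = Complex.reCLM ∘ fun τ => ⟪x τ, x τ⟫_ℂ := by
    funext τ
    simp [← inner_self_eq_norm_sq (𝕜 := ℂ)]
  rw [e]
  convert! h using 1
  have h2 : (⟪x', x t⟫_ℂ).re = (⟪x t, x'⟫_ℂ).re := inner_re_symm (𝕜 := ℂ) _ _
  rw [Complex.reCLM_apply, Complex.add_re, h2]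
  ring

/-- Conservation of the energy `‖f²‖²` along the Szegő flow, assuming only that the energy is
differentiable in time. -/
theorem energy_eq {x : ℝ → Hardy} (hW : ∀ t, InW (x t))
    (hx : ∀ t, HasDerivAt x (-Complex.I • nonlin (x t)) t)
    (hE : Differentiable ℝ fun t => ‖mulOp (x t) (x t)‖ ^ 2) (t s : ℝ) :
    ‖mulOp (x t) (x t)‖ ^ 2 = ‖mulOp (x s) (x s)‖ ^ 2 := by
  refine is_const_of_deriv_eq_zero hE (fun s => ?_) t s
  set L := wienerNorm (x s)
  have hsub : HasDerivAt (fun τ => x τ - x s) (-Complex.I • nonlin (x s)) s := (hx s).sub_const _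
  have h1 := Complex.reCLM.hasFDerivAt.comp_hasDerivAt s
    ((hasDerivAt_const s (nonlin (x s))).inner ℂ hsub)
  have h2 := (((hE s).hasDerivAt.sub (h1.const_mul 4)).add
    ((hasDerivAt_norm_sq hsub).const_mul (2 * L ^ 2)))
  have hmin : IsLocalMin (((fun t => ‖mulOp (x t) (x t)‖ ^ 2) - fun τ =>
      4 * (Complex.reCLM ∘ fun τ => ⟪nonlin (x s), x τ - x s⟫_ℂ) τ) +
      fun τ => 2 * L ^ 2 * ‖x τ - x s‖ ^ 2) s := by
    refine Filter.Eventually.of_forall fun τ => ?_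
    have hw : InW (x τ - x s : Hardy) := by
      rw [lp.coeFn_sub]
      exact (hW τ).sub (hW s)
    have h := norm_sq_mulOp_add_self (hW s) hw
    rw [add_sub_cancel] at h
    have hb := (Complex.abs_re_le_norm _).trans (norm_inner_mulOp_le (hW s) (hW s) hw)
    have hb' := (abs_le.1 hb).1
    simp only [Pi.add_apply, Pi.sub_apply, Function.comp_apply, sub_self, inner_zero_right,
      norm_zero, Complex.reCLM_apply, Complex.zero_re]
    nlinarith [sq_nonneg ‖(2 : ℝ) • mulOp (x s) (x τ - x s)
      + mulOp (x τ - x s : Hardy) (x τ - x s)‖]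
  have h3 := hmin.hasDerivAt_eq_zero h2
  simpa [inner_smul_right, ← Complex.ofReal_pow, inner_self_eq_norm_sq_to_K] using h3

theorem hasDerivAt_mulOp {v z : ℝ → ℕ → ℂ} {β : ℕ → ℝ} (hβ : Summable β)
    (hv : ∀ t n, ‖v t n‖ ≤ β n) (hz : ∀ t n, ‖z t n‖ ≤ β n)
    (hd : ∀ t n, HasDerivAt (fun τ => v τ n) (z t n) t) (t : ℝ) :
    HasDerivAt (fun τ => mulOp (v τ)) (mulOp (z t)) t := by
  refine hasDerivAt_tsum (g := fun n τ => v τ n • shiftCLM n)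
    (g' := fun n τ => z τ n • shiftCLM n) hβ (fun n τ => ?_)
    (fun n τ => (norm_smul_shiftCLM_le _ _).trans (hz τ n)) (y₀ := 0) ?_ t
  · exact ((ContinuousLinearMap.toSpanSingleton ℂ (shiftCLM n)).restrictScalars
      ℝ).hasFDerivAt.comp_hasDerivAt τ (hd τ n)
  · exact Summable.of_norm_bounded hβ fun n => (norm_smul_shiftCLM_le _ _).trans (hv 0 n)

theorem inner_nonlin_add_sub {v w z : Hardy} (hv : InW v) (hw : InW w) (hz : InW z) :
    ⟪z, nonlin (v + w) - nonlin v⟫_ℂ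
      = ⟪mulOp v z, (2 : ℝ) • mulOp v w + mulOp w w⟫_ℂ
        + ⟪mulOp z w, mulOp v v + ((2 : ℝ) • mulOp v w + mulOp w w)⟫_ℂ := by
  rw [inner_sub_right, inner_nonlin_right, inner_nonlin_right, mulOp_add_self hv hw,
    lp.coeFn_add, mulOp_add hv hw, add_apply, inner_add_left, mulOp_comm hz hw,
    inner_add_right (mulOp v z)]
  ring

theorem eq_zero_of_abs_deriv_le {Y Y' : ℝ → ℝ} {C : ℝ} (hY : ∀ t, HasDerivAt Y (Y' t) t)
    (hC : ∀ t, |Y' t| ≤ C * Y t) (hpos : ∀ t, 0 ≤ Y t) (h0 : Y 0 = 0) (t : ℝ) : Y t = 0 := by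
  refine le_antisymm ?_ (hpos t)
  have key : ∀ c τ, HasDerivAt (fun τ => Y τ * Real.exp (c * τ))
      ((Y' τ + c * Y τ) * Real.exp (c * τ)) τ := fun c τ => by
    convert! (hY τ).mul ((((hasDerivAt_id τ).const_mul c)).exp) using 1
    simp
    ring
  rcases le_total 0 t with ht | ht
  · have hanti : Antitone fun τ => Y τ * Real.exp (-C * τ) :=
      antitone_of_deriv_nonpos (fun τ => (key (-C) τ).differentiableAt) fun τ => by
        rw [(key (-C) τ).deriv]
        have := (abs_le.1 (hC τ)).2
        exact mul_nonpos_of_nonpos_of_nonneg (by linarith) (Real.exp_pos _).le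
    have h := hanti ht
    simp only [h0, zero_mul] at h
    exact nonpos_of_mul_nonpos_left h (Real.exp_pos _)
  · have hmono : Monotone fun τ => Y τ * Real.exp (C * τ) :=
      monotone_of_deriv_nonneg (fun τ => (key C τ).differentiableAt) fun τ => by
        rw [(key C τ).deriv]
        have := (abs_le.1 (hC τ)).1
        exact mul_nonneg (by linarith) (Real.exp_pos _).le
    have h := hmono ht
    simp only [h0, zero_mul] at h
    exact nonpos_of_mul_nonpos_left h (Real.exp_pos _)

/-- Pointwise relative energy estimates for the Szegő nonlinearity. -/
theorem relative_energy_bounds {v w z : Hardy} {L : ℝ} (hv : InW v) (hw : InW w) (hz : InW z)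
    (hvL : wienerNorm v ≤ L) (hzL : wienerNorm z ≤ L) :
    |(⟪mulOp v v, mulOp w w⟫_ℂ).re| ≤ L ^ 2 * ‖w‖ ^ 2 ∧
    ‖mulOp w w‖ ^ 2 ≤ 2 * ‖(2 : ℝ) • mulOp v w + mulOp w w‖ ^ 2 + 8 * L ^ 2 * ‖w‖ ^ 2 ∧
    |(⟪w, nonlin (v + w) - nonlin v⟫_ℂ).im| ≤ 2 * L ^ 2 * ‖w‖ ^ 2 + ‖mulOp w w‖ ^ 2 ∧
    |(⟪mulOp v z, mulOp w w⟫_ℂ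
        + ⟪mulOp z w, (2 : ℝ) • mulOp v w + mulOp w w⟫_ℂ).re|
      ≤ 4 * L ^ 2 * ‖w‖ ^ 2 + ‖mulOp w w‖ ^ 2 := by
  have hL : 0 ≤ L := (wienerNorm_nonneg _).trans hvL
  have hB : ‖mulOp v w‖ ≤ L * ‖w‖ :=
    (norm_mulOp_apply_le hv w).trans (by gcongr)
  have hzw : ‖mulOp z w‖ ≤ L * ‖w‖ :=
    (norm_mulOp_apply_le hz w).trans (by gcongr)
  have hAD : ‖⟪mulOp v v, mulOp w w⟫_ℂ‖ ≤ L ^ 2 * ‖w‖ ^ 2 :=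
    (norm_inner_mulOp_le hv hv hw).trans (by
      rw [sq L]
      gcongr
      exact wienerNorm_nonneg _)
  have hzD : ‖⟪mulOp v z, mulOp w w⟫_ℂ‖ ≤ L ^ 2 * ‖w‖ ^ 2 :=
    (norm_inner_mulOp_le hv hz hw).trans (by
      rw [sq L]
      gcongr
      exact wienerNorm_nonneg _)
  have hB2 : ‖(2 : ℝ) • mulOp v w‖ ≤ 2 * (L * ‖w‖) := by
    rw [norm_smul]
    simpa using hB
  have hBD : ‖⟪mulOp v w, mulOp w w⟫_ℂ‖ ≤ L * ‖w‖ * ‖mulOp w w‖ :=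
    (norm_inner_le_norm _ _).trans (by gcongr)
  have hw0 := norm_nonneg w
  have hD0 := norm_nonneg (mulOp w w)
  refine ⟨(Complex.abs_re_le_norm _).trans hAD, ?_, ?_, ?_⟩
  · have h : ‖mulOp w w‖ ≤ ‖(2 : ℝ) • mulOp v w + mulOp w w‖ + 2 * (L * ‖w‖) := by
      calc ‖mulOp w w‖ = ‖((2 : ℝ) • mulOp v w + mulOp w w) - (2 : ℝ) • mulOp v w‖ := by
            rw [add_sub_cancel_left]
        _ ≤ _ := (norm_sub_le _ _).trans (by gcongr)
    calc ‖mulOp w w‖ ^ 2 ≤ (‖(2 : ℝ) • mulOp v w + mulOp w w‖ + 2 * (L * ‖w‖)) ^ 2 := by gcongr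
      _ ≤ _ := by
        nlinarith [sq_nonneg (‖(2 : ℝ) • mulOp v w + mulOp w w‖ - 2 * (L * ‖w‖))]
  · have e : (⟪w, nonlin (v + w) - nonlin v⟫_ℂ).im
        = -(⟪mulOp v v, mulOp w w⟫_ℂ).im - (⟪mulOp v w, mulOp w w⟫_ℂ).im := by
      rw [inner_nonlin_add_sub hv hw hw, inner_add_right, inner_add_right, inner_add_right,
        two_smul, inner_add_right, inner_add_right, ← inner_conj_symm (mulOp w w) (mulOp v v),
        ← inner_conj_symm (mulOp w w) (mulOp v w)]
      simp only [Complex.add_im, Complex.conj_im]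
      have h1 : (⟪mulOp v w, mulOp v w⟫_ℂ).im = 0 := inner_self_im (𝕜 := ℂ) _
      have h2 : (⟪mulOp w w, mulOp w w⟫_ℂ).im = 0 := inner_self_im (𝕜 := ℂ) _
      rw [h1, h2]
      ring
    rw [e]
    have h1 := (Complex.abs_im_le_norm _).trans hAD
    have h2 := (Complex.abs_im_le_norm _).trans hBD
    calc _ ≤ |(⟪mulOp v v, mulOp w w⟫_ℂ).im| + |(⟪mulOp v w, mulOp w w⟫_ℂ).im| := by
          rw [← abs_neg (⟪mulOp v v, mulOp w w⟫_ℂ).im]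
          exact abs_sub _ _
      _ ≤ L ^ 2 * ‖w‖ ^ 2 + L * ‖w‖ * ‖mulOp w w‖ := add_le_add h1 h2
      _ ≤ _ := by nlinarith [sq_nonneg (L * ‖w‖ - ‖mulOp w w‖), sq_nonneg (L * ‖w‖)]
  · have h3 : ‖⟪mulOp z w, (2 : ℝ) • mulOp v w + mulOp w w⟫_ℂ‖
        ≤ L * ‖w‖ * (2 * (L * ‖w‖) + ‖mulOp w w‖) :=
      (norm_inner_le_norm _ _).trans
        (mul_le_mul hzw ((norm_add_le _ _).trans (by gcongr)) (norm_nonneg _) (by positivity))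
    calc _ ≤ ‖⟪mulOp v z, mulOp w w⟫_ℂ
          + ⟪mulOp z w, (2 : ℝ) • mulOp v w + mulOp w w⟫_ℂ‖ := Complex.abs_re_le_norm _
      _ ≤ L ^ 2 * ‖w‖ ^ 2 + L * ‖w‖ * (2 * (L * ‖w‖) + ‖mulOp w w‖) :=
        (norm_add_le _ _).trans (add_le_add hzD h3)
      _ ≤ _ := by nlinarith [sq_nonneg (L * ‖w‖ - ‖mulOp w w‖), sq_nonneg (L * ‖w‖)]

/-- Weak–strong uniqueness for the cubic Szegő equation: a solution with differentiable energy
coincides with a solution that is `C¹` with values in the Wiener algebra and has the same datum. -/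
theorem weak_strong_uniqueness {u v z : ℝ → Hardy} {β : ℕ → ℝ} (hβ : Summable β)
    (huW : ∀ t, InW (u t)) (hu : ∀ t, HasDerivAt u (-Complex.I • nonlin (u t)) t)
    (huE : Differentiable ℝ fun t => ‖mulOp (u t) (u t)‖ ^ 2)
    (hvβ : ∀ t n, ‖v t n‖ ≤ β n) (hzβ : ∀ t n, ‖z t n‖ ≤ β n)
    (hvz : ∀ t n, HasDerivAt (fun τ => v τ n) (z t n) t)
    (hz : ∀ t, z t = -Complex.I • nonlin (v t)) (h0 : u 0 = v 0) (t : ℝ) : u t = v t := by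
  have hvW : ∀ t, InW (v t) := fun t =>
    Summable.of_nonneg_of_le (fun _ => norm_nonneg _) (hvβ t) hβ
  have hzW : ∀ t, InW (z t) := fun t =>
    Summable.of_nonneg_of_le (fun _ => norm_nonneg _) (hzβ t) hβ
  set L := ∑' n, β n
  have hvL : ∀ t, wienerNorm (v t) ≤ L := fun t => (hvW t).tsum_le_tsum (hvβ t) hβ
  have hzL : ∀ t, wienerNorm (z t) ≤ L := fun t => (hzW t).tsum_le_tsum (hzβ t) hβ
  have hop : ∀ t, HasDerivAt (fun τ => mulOp (v τ)) (mulOp (z t)) t :=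
    hasDerivAt_mulOp hβ hvβ hzβ hvz
  have hopx : ∀ {x : ℝ → Hardy} {x' : Hardy} {t : ℝ}, HasDerivAt x x' t →
      HasDerivAt (fun τ => mulOp (v τ) (x τ)) (mulOp (z t) (x t) + mulOp (v t) x') t := by
    intro x x' t hx
    exact ((ContinuousLinearMap.restrictScalarsL ℂ Hardy Hardy ℝ ℝ).hasFDerivAt.comp_hasDerivAt t
      (hop t)).clm_apply hx
  have hv : ∀ t, HasDerivAt v (z t) t := by
    have e : v = fun τ => mulOp (v τ) (lp.single 2 0 1) := by
      funext τ
      ext n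
      rw [mulOp_single_zero (hvW τ)]
    intro t
    have h := hopx (hasDerivAt_const t (lp.single 2 0 1 : Hardy))
    rw [← e, map_zero, add_zero] at h
    convert h using 1
    ext n
    rw [mulOp_single_zero (hzW t)]
  have hA : ∀ t, HasDerivAt (fun τ => mulOp (v τ) (v τ)) ((2 : ℝ) • mulOp (v t) (z t)) t := by
    intro t
    rw [two_smul]
    nth_rw 1 [mulOp_comm (hvW t) (hzW t)]
    exact hopx (hv t)
  set w : ℝ → Hardy := fun t => u t - v t with hwdef
  have hwW : ∀ t, InW (w t) := fun t => by
    rw [hwdef, lp.coeFn_sub]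
    exact (huW t).sub (hvW t)
  have huvw : ∀ t, u t = v t + w t := fun t => (add_sub_cancel _ _).symm
  have hw : ∀ t, HasDerivAt w (-Complex.I • (nonlin (v t + w t) - nonlin (v t))) t := fun t => by
    rw [smul_sub, ← huvw, ← hz]
    exact (hu t).sub (hv t)
  have hEu := energy_eq huW hu huE
  have hEv := energy_eq hvW (fun t => hz t ▸ hv t)
    (fun t => (hasDerivAt_norm_sq (hA t)).differentiableAt)
  have hE : ∀ t, ‖mulOp (u t) (u t)‖ ^ 2 = ‖mulOp (v t) (v t)‖ ^ 2 := fun t => by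
    rw [hEu t 0, hEv t 0, h0]
  set K := 6 * L ^ 2 + 1
  set Y : ℝ → ℝ := fun t =>
    -4 * (⟪mulOp (v t) (v t), mulOp (v t) (w t)⟫_ℂ).re + K * ‖w t‖ ^ 2 with hYdef
  set Y' : ℝ → ℝ := fun t =>
    4 * (⟪mulOp (v t) (z t), mulOp (w t) (w t)⟫_ℂ + ⟪mulOp (z t) (w t),
      (2 : ℝ) • mulOp (v t) (w t) + mulOp (w t) (w t)⟫_ℂ).re
    + K * (2 * (⟪w t, nonlin (v t + w t) - nonlin (v t)⟫_ℂ).im) with hY'def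
  have hY : ∀ t, HasDerivAt Y (Y' t) t := by
    intro t
    have h1 := Complex.reCLM.hasFDerivAt.comp_hasDerivAt t ((hA t).inner ℂ (hopx (hw t)))
    have h2 := (h1.const_mul (-4)).add ((hasDerivAt_norm_sq (hw t)).const_mul K)
    convert! h2 using 1
    have e1 : ⟪mulOp (v t) (v t), mulOp (v t) (-Complex.I •
        (nonlin (v t + w t) - nonlin (v t)))⟫_ℂ
        = -⟪z t, nonlin (v t + w t) - nonlin (v t)⟫_ℂ := by
      rw [← inner_nonlin, hz t, inner_smul_left, inner_smul_right]
      simp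
    rw [Complex.reCLM_apply, inner_add_right, e1,
      inner_nonlin_add_sub (hvW t) (hwW t) (hzW t), inner_add_right (mulOp (v t) (z t)),
      inner_add_right (mulOp (z t) (w t)) (mulOp (v t) (v t)), two_smul ℝ (mulOp (v t) (z t)),
      two_smul ℝ (mulOp (v t) (w t)), inner_add_left, inner_add_right (mulOp (v t) (z t)),
      ← inner_conj_symm (mulOp (v t) (v t)) (mulOp (z t) (w t)), inner_smul_right]
    have e2 : (-Complex.I * ⟪w t, nonlin (v t + w t) - nonlin (v t)⟫_ℂ).re
        = (⟪w t, nonlin (v t + w t) - nonlin (v t)⟫_ℂ).im := by simp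
    rw [e2]
    simp only [hY'def, two_smul, Complex.add_re, Complex.neg_re, Complex.conj_re]
    ring
  have hest := fun t => relative_energy_bounds (hvW t) (hwW t) (hzW t) (hvL t) (hzL t)
  have hYpos : ∀ t, ‖mulOp (w t) (w t)‖ ^ 2 / 2 + ‖w t‖ ^ 2 ≤ Y t := by
    intro t
    obtain ⟨h1, h2, -, -⟩ := hest t
    have h3 := norm_sq_mulOp_add_self (hvW t) (hwW t)
    rw [← huvw, hE t, inner_nonlin] at h3
    have h4 := (abs_le.1 h1).1
    simp only [hYdef, K]
    linarith
  have hYzero := eq_zero_of_abs_deriv_le hY (C := 16 * L ^ 2 + 8 + K * (4 * L ^ 2 + 4))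
    (fun t => ?_) (fun t => le_trans (by positivity) (hYpos t)) (by simp [hYdef, hwdef, h0]) t
  · have h := hYpos t
    rw [hYzero] at h
    have hsq : ‖w t‖ ^ 2 = 0 :=
      le_antisymm (by linarith [sq_nonneg ‖mulOp (w t) (w t)‖]) (sq_nonneg _)
    exact sub_eq_zero.1 (norm_eq_zero.1 (pow_eq_zero_iff two_ne_zero |>.1 hsq))
  · obtain ⟨-, -, h3, h4⟩ := hest t
    have hK : 0 ≤ K := by positivity
    have hy := sq_nonneg ‖w t‖
    have hD := sq_nonneg ‖mulOp (w t) (w t)‖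
    have hp := hYpos t
    have hyY : ‖w t‖ ^ 2 ≤ Y t := by linarith
    have hDY : ‖mulOp (w t) (w t)‖ ^ 2 ≤ 2 * Y t := by linarith
    have hb3 : 2 * L ^ 2 * ‖w t‖ ^ 2 + ‖mulOp (w t) (w t)‖ ^ 2 ≤ (2 * L ^ 2 + 2) * Y t := by
      nlinarith [sq_nonneg L]
    have hb4 : 4 * L ^ 2 * ‖w t‖ ^ 2 + ‖mulOp (w t) (w t)‖ ^ 2 ≤ (4 * L ^ 2 + 2) * Y t := by
      nlinarith [sq_nonneg L]
    have h3' := h3.trans hb3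
    have h4' := h4.trans hb4
    refine (abs_add_le _ _).trans ?_
    rw [abs_mul, abs_mul, abs_mul, abs_of_nonneg hK, abs_two,
      abs_of_pos (four_pos : (0 : ℝ) < 4)]
    refine (add_le_add (mul_le_mul_of_nonneg_left h4' zero_le_four)
      (mul_le_mul_of_nonneg_left (mul_le_mul_of_nonneg_left h3' zero_le_two) hK)).trans_eq ?_
    ring

/-- Fourier coefficients of the rational function `b + c e^{ix} / (1 - p e^{ix})`. -/
def ratSeq (b c p : ℂ) : ℕ → ℂ
  | 0 => b
  | j + 1 => c * p ^ j

theorem mulCoeff_ratSeq_succ (b c p : ℂ) (m : ℕ) :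
    mulCoeff (ratSeq b c p) (ratSeq b c p) (m + 1)
      = 2 * b * c * p ^ m + m * c ^ 2 * p ^ (m - 1) := by
  rw [mulCoeff, Finset.sum_range_succ, Finset.sum_range_succ']
  have h : ∀ i ∈ Finset.range m,
      ratSeq b c p (i + 1) * ratSeq b c p (m + 1 - (i + 1)) = c ^ 2 * p ^ (m - 1) := by
    intro i hi
    have hi' : i < m := Finset.mem_range.1 hi
    rw [show m + 1 - (i + 1) = (m - 1 - i) + 1 by omega]
    simp only [ratSeq]
    rw [show m - 1 = i + (m - 1 - i) by omega, pow_add,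
      show i + (m - 1 - i) - i = m - 1 - i by omega]
    ring
  rw [Finset.sum_congr rfl h]
  simp [ratSeq]
  ring

theorem szegoNL_ratSeq {b c p r : ℂ} (hp : ‖p‖ < 1) (hr : p * conj p = 1 - r)
    (hc : c * conj c = r ^ 2) :
    szegoNL (ratSeq b c p) 0 = b * conj b * b + 2 * b * r + c * conj p ∧
    ∀ j : ℕ, szegoNL (ratSeq b c p) (j + 1)
      = (2 * b * conj b * c + 2 * b * p * r + c) * p ^ j
        + c * (j * p ^ (j - 1) * (conj b * c + r * p)) := by
  have hx : ‖p * conj p‖ < 1 := by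
    rw [norm_mul, RCLike.norm_conj]
    nlinarith [norm_nonneg p]
  have hr0 : r ≠ 0 := by
    rintro rfl
    rw [hr] at hx
    simp at hx
  have hg := hasSum_geometric_of_norm_lt_one hx
  have hg' := hasSum_coe_mul_geometric_of_norm_lt_one hx
  have hr1 : 1 - p * conj p = r := by rw [hr]; ring
  rw [hr1] at hg hg'
  constructor
  · have h1 : HasSum (fun l : ℕ => (l : ℂ) * conj p ^ l * p ^ (l - 1)) (conj p / r ^ 2) := by
      rw [← hasSum_nat_add_iff' 1]
      convert! (hg.add hg').mul_left (conj p) using 1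
      · funext l
        push_cast
        rw [mul_pow]
        ring
      · rw [hr]
        simp
        field_simp
        ring
    have h2 : HasSum (fun q => conj (ratSeq b c p q)
        * mulCoeff (ratSeq b c p) (ratSeq b c p) (0 + q))
        (b * conj b * b + 2 * b * r + c * conj p) := by
      rw [← hasSum_nat_add_iff' 1]
      convert! (hg.mul_left (2 * b * (c * conj c))).add (h1.mul_left (c * (c * conj c))) using 1
      · funext l
        rw [zero_add, mulCoeff_ratSeq_succ]
        simp only [ratSeq, map_mul, map_pow, mul_pow]
        ring
      · rw [hc]
        simp [mulCoeff, ratSeq]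
        field_simp
        ring
    exact h2.tsum_eq
  · intro j
    have h2 : HasSum (fun q => conj (ratSeq b c p q)
        * mulCoeff (ratSeq b c p) (ratSeq b c p) (j + 1 + q))
        ((2 * b * conj b * c + 2 * b * p * r + c) * p ^ j
        + c * (j * p ^ (j - 1) * (conj b * c + r * p))) := by
      rw [← hasSum_nat_add_iff' 1]
      convert! (hg.mul_left (2 * b * (c * conj c) * p ^ (j + 1)
        + (j + 1) * c * (c * conj c) * p ^ j)).add
        (hg'.mul_left (c * (c * conj c) * p ^ j)) using 1
      · funext l
        rw [show j + 1 + (l + 1) = (j + 1 + l) + 1 by omega, mulCoeff_ratSeq_succ,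
          show j + 1 + l - 1 = j + l by omega]
        simp only [ratSeq, map_mul, map_pow, mul_pow]
        push_cast
        ring
      · rw [hc, hr]
        simp only [Finset.range_one, Finset.sum_singleton, add_zero, mulCoeff_ratSeq_succ]
        have hj : (j : ℂ) * p ^ (j - 1) * p = j * p ^ j := by
          cases j with
          | zero => simp
          | succ i => simp [pow_succ, mul_assoc]
        simp only [ratSeq]
        field_simp
        linear_combination (c * r) * hj
    exact h2.tsum_eq

/-- The residue coefficient `c = a + b p` of the explicit solution. -/
def szC (ε t : ℝ) : ℂ :=
  Complex.exp (-(Complex.I * t * (1 + ε ^ 2))) *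
    (Real.cos (szOmega ε * t)
      - Complex.I * ε * (Real.sin (szOmega ε * t) / Real.sqrt (4 + ε ^ 2) : ℝ)) ^ 2

theorem sz_polar (ε t : ℝ) : ∃ (z e : ℂ) (k σ : ℝ), z * conj z = 1 ∧ e * conj e = 1 ∧
    k ^ 2 + (4 + ε ^ 2) * σ ^ 2 = 1 ∧ |σ| * Real.sqrt (4 + ε ^ 2) ≤ 1 ∧
    szA ε t = z * e ^ 2 ∧
    szB ε t = z * e * (ε * k - Complex.I * (2 + ε ^ 2) * σ) ∧
    szC ε t = z * e ^ 2 * (k - Complex.I * ε * σ) ^ 2 ∧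
    szP ε t = -2 * Complex.I * σ * e ∧
    HasDerivAt (szB ε) (-Complex.I * (1 + ε ^ 2 / 2) * z * e *
      (ε * k - Complex.I * (2 + ε ^ 2) * σ) + z * e *
      (ε * (-(ε / 2) * (4 + ε ^ 2) * σ) - Complex.I * (2 + ε ^ 2) * (ε / 2 * k))) t ∧
    HasDerivAt (szC ε) (-Complex.I * (1 + ε ^ 2) * z * e ^ 2 * (k - Complex.I * ε * σ) ^ 2
      + z * e ^ 2 * (2 * (k - Complex.I * ε * σ)
        * (-(ε / 2) * (4 + ε ^ 2) * σ - Complex.I * ε * (ε / 2 * k)))) t ∧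
    HasDerivAt (szP ε) (-2 * Complex.I * (ε / 2 * k) * e
      + -2 * Complex.I * σ * (-Complex.I * ε ^ 2 / 2 * e)) t := by
  set q := Real.sqrt (4 + ε ^ 2) with hq
  have hq0 : 0 < q := Real.sqrt_pos.2 (by positivity)
  have hq2 : q ^ 2 = 4 + ε ^ 2 := Real.sq_sqrt (by positivity)
  have hqC : (q : ℂ) ≠ 0 := by exact_mod_cast hq0.ne'
  have hω : szOmega ε = ε / 2 * q := rfl
  have hexp : ∀ x : ℝ,
      Complex.exp (-(Complex.I * x)) * conj (Complex.exp (-(Complex.I * x))) = 1 := by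
    intro x
    rw [← Complex.exp_conj, ← Complex.exp_add]
    simp
  have hid : ∀ c : ℂ, HasDerivAt (fun τ : ℝ => Complex.exp (-(Complex.I * τ * c)))
      (-Complex.I * c * Complex.exp (-(Complex.I * t * c))) t := by
    intro c
    convert! (((((hasDerivAt_id t).ofReal_comp).const_mul Complex.I).mul_const c).neg).cexp using 1
    simp
    ring
  have hlin : HasDerivAt (fun τ : ℝ => szOmega ε * τ) (szOmega ε) t := by
    simpa using (hasDerivAt_id t).const_mul (szOmega ε)
  have hk : HasDerivAt (fun τ : ℝ => ((Real.cos (szOmega ε * τ) : ℝ) : ℂ))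
      (-(ε / 2) * (4 + ε ^ 2) * (Real.sin (szOmega ε * t) / q : ℝ)) t := by
    convert! (hlin.cos).ofReal_comp using 1
    have : (q : ℂ) ^ 2 = 4 + ε ^ 2 := by exact_mod_cast hq2
    rw [hω]
    push_cast
    rw [← this]
    field_simp
  have hs : HasDerivAt (fun τ : ℝ => ((Real.sin (szOmega ε * τ) / q : ℝ) : ℂ))
      (ε / 2 * (Real.cos (szOmega ε * t) : ℝ)) t := by
    convert! ((hlin.sin).div_const q).ofReal_comp using 1
    rw [hω]
    push_cast
    field_simp
  have e1 : ∀ τ : ℝ, Complex.exp (-(Complex.I * τ * (1 + ε ^ 2 / 2)))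
      = Complex.exp (-(Complex.I * τ)) * Complex.exp (-(Complex.I * τ * (ε ^ 2 / 2))) := by
    intro τ
    rw [← Complex.exp_add]
    ring_nf
  have e2 : ∀ τ : ℝ, Complex.exp (-(Complex.I * τ * (1 + ε ^ 2)))
      = Complex.exp (-(Complex.I * τ)) * Complex.exp (-(Complex.I * τ * (ε ^ 2 / 2))) ^ 2 := by
    intro τ
    rw [← Complex.exp_nat_mul, ← Complex.exp_add]
    congr 1
    push_cast
    ring
  have hB : szB ε = fun τ : ℝ => Complex.exp (-(Complex.I * τ * (1 + ε ^ 2 / 2))) *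
      (ε * (Real.cos (szOmega ε * τ) : ℝ)
        - Complex.I * (2 + ε ^ 2) * (Real.sin (szOmega ε * τ) / q : ℝ)) := by
    funext τ
    rw [szB, ← hq]
    push_cast
    ring
  have hP : szP ε = fun τ : ℝ => -2 * Complex.I * (Real.sin (szOmega ε * τ) / q : ℝ) *
      Complex.exp (-(Complex.I * τ * (ε ^ 2 / 2))) := by
    funext τ
    rw [szP, ← hq, mul_div_assoc (Complex.I * (τ : ℂ))]
    push_cast
    ring
  refine ⟨Complex.exp (-(Complex.I * t)), Complex.exp (-(Complex.I * t * (ε ^ 2 / 2))),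
    Real.cos (szOmega ε * t), Real.sin (szOmega ε * t) / q, hexp t, ?_, ?_, ?_, ?_, ?_, ?_, ?_,
    ?_, ?_, ?_⟩
  · have h := hexp (t * (ε ^ 2 / 2))
    push_cast at h
    rwa [← mul_assoc] at h
  · rw [← hq2, div_pow, mul_div_cancel₀ _ (by positivity)]
    exact Real.cos_sq_add_sin_sq _
  · rw [abs_div, abs_of_pos hq0, div_mul_cancel₀ _ hq0.ne']
    exact Real.abs_sin_le_one _
  · rw [szA, e2]
  · simp only [hB, e1]
  · rw [szC, e2]
  · rw [hP]
  · rw [hB]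
    convert! (hid (1 + ε ^ 2 / 2)).mul ((hk.const_mul (ε : ℂ)).sub
      (hs.const_mul (Complex.I * (2 + ε ^ 2)))) using 1
    simp only [e1, Pi.sub_apply]
    ring
  · unfold szC
    rw [← hq]
    convert! (hid (1 + ε ^ 2)).mul ((hk.sub (hs.const_mul (Complex.I * ε))).pow 2) using 1
    simp only [e2, Pi.sub_apply, Pi.pow_apply]
    push_cast
    ring
  · rw [hP]
    convert! (hs.const_mul (-2 * Complex.I)).mul (hid (ε ^ 2 / 2)) using 1
    ring

theorem szA_add_szB_mul_szP (ε t : ℝ) : szA ε t + szB ε t * szP ε t = szC ε t := by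
  obtain ⟨z, e, k, σ, hz, he, hkσ, hσ, hA, hB, hC, hP, -⟩ := sz_polar ε t
  have h : (k : ℂ) ^ 2 + (4 + ε ^ 2) * σ ^ 2 = 1 := by exact_mod_cast hkσ
  rw [hA, hB, hC, hP]
  linear_combination (-z * e ^ 2) * h
    + z * e ^ 2 * (4 * σ ^ 2 + 2 * ε ^ 2 * σ ^ 2 - ε ^ 2 * σ ^ 2) * Complex.I_sq

/-- The parameters of the explicit solution satisfy the reduced system of the Szegő flow. -/
theorem sz_ode (ε t : ℝ) : ∃ r : ℝ, 0 ≤ r ∧ r ≤ 1 ∧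
    ‖szP ε t‖ ≤ 2 / Real.sqrt (4 + ε ^ 2) ∧
    ‖szB ε t‖ ≤ |ε| + (2 + ε ^ 2) ∧ ‖szC ε t‖ ≤ 1 ∧
    szP ε t * conj (szP ε t) = 1 - r ∧ szC ε t * conj (szC ε t) = r ^ 2 ∧
    HasDerivAt (szB ε) (-Complex.I * (szB ε t * conj (szB ε t) * szB ε t + 2 * szB ε t * r
      + szC ε t * conj (szP ε t))) t ∧
    HasDerivAt (szC ε) (-Complex.I * (2 * szB ε t * conj (szB ε t) * szC ε t
      + 2 * szB ε t * szP ε t * r + szC ε t)) t ∧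
    HasDerivAt (szP ε) (-Complex.I * (conj (szB ε t) * szC ε t + r * szP ε t)) t := by
  obtain ⟨z, e, k, σ, hz, he, hkσ, hσ, hA, hB, hC, hP, hB', hC', hP'⟩ := sz_polar ε t
  have h : (k : ℂ) ^ 2 + (4 + ε ^ 2) * σ ^ 2 = 1 := by exact_mod_cast hkσ
  have hnz : ∀ x : ℂ, x * conj x = 1 → ‖x‖ = 1 := fun x hx => by
    rw [Complex.mul_conj, Complex.ofReal_eq_one, Complex.normSq_eq_norm_sq] at hx
    exact (pow_eq_one_iff_of_nonneg (norm_nonneg x) two_ne_zero).1 hx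
  have hz1 := hnz z hz
  have he1 := hnz e he
  have hq0 : 0 < Real.sqrt (4 + ε ^ 2) := Real.sqrt_pos.2 (by positivity)
  have hI := Complex.I_sq
  have hσ1 : |σ| ≤ 1 := by
    rw [← sq_le_one_iff_abs_le_one]
    nlinarith [sq_nonneg k, sq_nonneg (ε * σ)]
  have hk1 : |k| ≤ 1 := by
    rw [← sq_le_one_iff_abs_le_one]
    nlinarith [sq_nonneg σ, sq_nonneg (ε * σ)]
  have hγ : (k - Complex.I * ε * σ) * (k + Complex.I * ε * σ) = 1 - 4 * (σ : ℂ) ^ 2 := by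
    linear_combination h - (ε ^ 2 * σ ^ 2 : ℂ) * hI
  have hβγ : (ε * k - Complex.I * (2 + ε ^ 2) * σ) * (k + Complex.I * ε * σ)
      + 2 * Complex.I * σ * (k - Complex.I * ε * σ) = ε := by
    linear_combination (ε : ℂ) * h - ((2 + ε ^ 2) * ε * σ ^ 2 + 2 * ε * σ ^ 2 : ℂ) * hI
  have hβγ' : (ε * k + Complex.I * (2 + ε ^ 2) * σ) * (k - Complex.I * ε * σ)
      - 2 * Complex.I * σ * (k + Complex.I * ε * σ) = ε := by
    linear_combination (ε : ℂ) * h - ((2 + ε ^ 2) * ε * σ ^ 2 + 2 * ε * σ ^ 2 : ℂ) * hI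
  have hS : (ε * k - Complex.I * (2 + ε ^ 2) * σ) * (ε ^ 2 + 4 * σ ^ 2 + 2 * (1 - 4 * σ ^ 2))
      + 2 * Complex.I * σ * (k - Complex.I * ε * σ) ^ 2
      = ε * k * (2 + ε ^ 2) - Complex.I * (2 + ε ^ 2) ^ 2 * σ + 2 * Complex.I * σ := by
    linear_combination (2 * Complex.I * σ) * h
      + (-4 * ε * k * σ ^ 2 + 2 * Complex.I * ε ^ 2 * σ ^ 3) * hI
  have hBB : szB ε t * conj (szB ε t) = ε ^ 2 + 4 * σ ^ 2 := by
    rw [hB]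
    simp only [map_mul, map_sub, map_add, map_pow, Complex.conj_I, Complex.conj_ofReal, map_ofNat]
    linear_combination (e * conj e * (ε * k - Complex.I * (2 + ε ^ 2) * σ)
      * (ε * k + Complex.I * (2 + ε ^ 2) * σ)) * hz
      + ((ε * k - Complex.I * (2 + ε ^ 2) * σ) * (ε * k + Complex.I * (2 + ε ^ 2) * σ)) * he
      - (2 + ε ^ 2) ^ 2 * σ ^ 2 * hI + ε ^ 2 * h
  have hCP : szC ε t * conj (szP ε t)
      = z * e * (2 * Complex.I * σ * (k - Complex.I * ε * σ) ^ 2) := by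
    rw [hC, hP]
    simp only [map_mul, map_neg, Complex.conj_I, Complex.conj_ofReal, map_ofNat]
    linear_combination (z * e * (2 * Complex.I * σ * (k - Complex.I * ε * σ) ^ 2)) * he
  have hBC : conj (szB ε t) * szC ε t
      = e * (ε * k + Complex.I * (2 + ε ^ 2) * σ) * (k - Complex.I * ε * σ) ^ 2 := by
    rw [hB, hC]
    simp only [map_mul, map_sub, map_add, map_pow, Complex.conj_I, Complex.conj_ofReal, map_ofNat]
    linear_combination (e ^ 2 * conj e * (ε * k + Complex.I * (2 + ε ^ 2) * σ)
      * (k - Complex.I * ε * σ) ^ 2) * hz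
      + (e * (ε * k + Complex.I * (2 + ε ^ 2) * σ) * (k - Complex.I * ε * σ) ^ 2) * he
  refine ⟨1 - 4 * σ ^ 2, ?_, ?_, ?_, ?_, ?_, ?_, ?_, ?_, ?_, ?_⟩
  · nlinarith [sq_nonneg k, sq_nonneg (ε * σ)]
  · nlinarith [sq_nonneg σ]
  · rw [hP]
    simp only [norm_mul, norm_neg, he1, Complex.norm_I, Complex.norm_real, Real.norm_eq_abs]
    rw [le_div_iff₀ hq0]
    norm_num
    linarith
  · rw [hB, norm_mul, norm_mul, hz1, he1, one_mul, one_mul]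
    refine (norm_sub_le _ _).trans (add_le_add ?_ ?_)
    · rw [norm_mul, Complex.norm_real, Complex.norm_real, Real.norm_eq_abs, Real.norm_eq_abs]
      exact mul_le_of_le_one_right (abs_nonneg _) hk1
    · rw [norm_mul, norm_mul, Complex.norm_I, one_mul, Complex.norm_real, Real.norm_eq_abs]
      have : ‖(2 + ε ^ 2 : ℂ)‖ = 2 + ε ^ 2 := by
        rw [show (2 + ε ^ 2 : ℂ) = ((2 + ε ^ 2 : ℝ) : ℂ) by push_cast; ring, Complex.norm_real,
          Real.norm_of_nonneg (by positivity)]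
      rw [this]
      exact mul_le_of_le_one_right (by positivity) hσ1
  · rw [hC, norm_mul, norm_mul, norm_pow, norm_pow, hz1, he1, ← Complex.normSq_eq_norm_sq]
    simp [Complex.normSq_apply]
    nlinarith [sq_nonneg σ]
  · rw [hP]
    simp only [map_mul, map_neg, Complex.conj_I, Complex.conj_ofReal, map_ofNat]
    push_cast
    linear_combination (-4 * Complex.I ^ 2 * σ ^ 2) * he - 4 * σ ^ 2 * hI
  · rw [hC]
    simp only [map_mul, map_sub, map_pow, Complex.conj_I, Complex.conj_ofReal]
    have h1 : (k - Complex.I * ε * σ) * (k - -Complex.I * ε * σ) = 1 - 4 * (σ : ℂ) ^ 2 := by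
      linear_combination h - (ε ^ 2 * σ ^ 2 : ℂ) * hI
    calc _ = (z * conj z) * (e * conj e) ^ 2
          * ((k - Complex.I * ε * σ) * (k - -Complex.I * ε * σ)) ^ 2 := by ring
      _ = _ := by
        rw [hz, he, h1]
        push_cast
        ring
  · convert! hB' using 1
    rw [hBB, hCP, hB]
    push_cast
    linear_combination (-Complex.I * z * e) * hS + (z * e * σ * ((2 + ε ^ 2) ^ 2 - 4) / 2) * hI
  · convert! hC' using 1
    have hBP : 2 * szB ε t * szP ε t = z * e ^ 2 * (-4 * Complex.I * σ
        * (ε * k - Complex.I * (2 + ε ^ 2) * σ)) := by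
      rw [hB, hP]
      ring
    rw [mul_assoc 2 (szB ε t), hBB, hBP, hC]
    push_cast
    linear_combination (-4 * Complex.I ^ 2 * σ * (ε * k - Complex.I * (2 + ε ^ 2) * σ)
        * z * e ^ 2) * hγ
      + (4 * Complex.I ^ 2 * σ * (k - Complex.I * ε * σ) * z * e ^ 2) * hβγ
      + (z * e ^ 2 * (k - Complex.I * ε * σ) * (-8 * Complex.I * σ ^ 2 * (k - Complex.I * ε * σ)
        + 4 * ε * σ + ε ^ 3 * σ)) * hI
  · convert! hP' using 1
    rw [hBC, hP]
    push_cast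
    linear_combination (-2 * Complex.I ^ 2 * σ * e) * hγ
      + (-Complex.I * (k - Complex.I * ε * σ) * e) * hβγ'

/-- A weight, summable for `ρ < 1`, dominating the sequences `ratSeq b c p` with `‖p‖ ≤ ρ` and
their derivatives with respect to the parameters. -/
def ratBound (ρ : ℝ) : ℕ → ℝ
  | 0 => 1
  | j + 1 => ρ ^ j + j * ρ ^ (j - 1)

theorem norm_ratSeq_le {b c p : ℂ} {M ρ N : ℝ} (hb : ‖b‖ ≤ M) (hc : ‖c‖ ≤ 1) (hp : ‖p‖ ≤ ρ)
    (hN : M + 1 ≤ N) (n : ℕ) : ‖ratSeq b c p n‖ ≤ N * ratBound ρ n := by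
  have hN1 : 1 ≤ N := by linarith [norm_nonneg b]
  have hρ : 0 ≤ ρ := (norm_nonneg p).trans hp
  cases n with
  | zero => simpa [ratSeq, ratBound] using by linarith
  | succ j =>
    simp only [ratSeq, ratBound, norm_mul, norm_pow]
    calc ‖c‖ * ‖p‖ ^ j ≤ 1 * ρ ^ j := by gcongr
      _ ≤ N * (ρ ^ j + j * ρ ^ (j - 1)) := by
        gcongr
        exact le_add_of_nonneg_right (by positivity)

theorem norm_szegoNL_ratSeq_le {b c p : ℂ} {r M ρ N : ℝ} (hb : ‖b‖ ≤ M) (hc : ‖c‖ ≤ 1)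
    (hp : ‖p‖ ≤ ρ) (hρ1 : ρ < 1) (hr0 : 0 ≤ r) (hr1 : r ≤ 1) (hr : p * conj p = 1 - r)
    (hcr : c * conj c = r ^ 2) (hN : M ^ 3 + 2 * M ^ 2 + 2 * M + 1 ≤ N) (n : ℕ) :
    ‖szegoNL (ratSeq b c p) n‖ ≤ N * ratBound ρ n := by
  obtain ⟨h0, h1⟩ := szegoNL_ratSeq (hp.trans_lt hρ1) hr hcr
  have hM : 0 ≤ M := (norm_nonneg b).trans hb
  have hρ : 0 ≤ ρ := (norm_nonneg p).trans hp
  have hp1 : ‖p‖ ≤ 1 := hp.trans hρ1.le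
  have hrn : ‖(r : ℂ)‖ ≤ 1 := by rwa [Complex.norm_real, Real.norm_of_nonneg hr0]
  have hM3 : 0 ≤ M ^ 3 := by positivity
  cases n with
  | zero =>
    rw [h0, ratBound, mul_one]
    calc ‖b * conj b * b + 2 * b * r + c * conj p‖
        ≤ ‖b‖ * ‖b‖ * ‖b‖ + 2 * ‖b‖ * ‖(r : ℂ)‖ + ‖c‖ * ‖p‖ := by
          refine (norm_add₃_le).trans_eq ?_
          simp only [norm_mul, RCLike.norm_conj, Complex.norm_ofNat]
      _ ≤ M * M * M + 2 * M * 1 + 1 * 1 := by gcongr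
      _ ≤ N := by nlinarith
  | succ j =>
    have e1 : ‖2 * b * conj b * c + 2 * b * p * r + c‖ ≤ 2 * M * M * 1 + 2 * M * 1 * 1 + 1 := by
      refine (norm_add₃_le).trans ?_
      simp only [norm_mul, RCLike.norm_conj, Complex.norm_ofNat]
      gcongr
    have e2 : ‖conj b * c + r * p‖ ≤ M * 1 + 1 * 1 := by
      refine (norm_add_le _ _).trans ?_
      simp only [norm_mul, RCLike.norm_conj]
      gcongr
    rw [h1, ratBound]
    calc _ ≤ ‖2 * b * conj b * c + 2 * b * p * r + c‖ * ‖p‖ ^ j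
          + ‖c‖ * (j * ‖p‖ ^ (j - 1) * ‖conj b * c + r * p‖) := by
          refine (norm_add_le _ _).trans_eq ?_
          rw [norm_mul, norm_mul, norm_mul, norm_mul, norm_pow, norm_pow, Complex.norm_natCast]
      _ ≤ N * ρ ^ j + 1 * (j * ρ ^ (j - 1) * N) := by
          have hN1 : 0 ≤ N := le_trans (by positivity) hN
          gcongr
          · nlinarith
          · nlinarith
      _ = _ := by ring

theorem summable_ratBound {ρ : ℝ} (h0 : 0 ≤ ρ) (h1 : ρ < 1) : Summable (ratBound ρ) := by
  have hn : ‖ρ‖ < 1 := by rwa [Real.norm_of_nonneg h0]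
  have hg : Summable fun n : ℕ => ρ ^ n := summable_geometric_of_norm_lt_one hn
  have hg' : Summable fun n : ℕ => (n : ℝ) * ρ ^ n := by
    simpa using summable_pow_mul_geometric_of_norm_lt_one 1 hn
  have h : Summable fun j : ℕ => (j : ℝ) * ρ ^ (j - 1) := by
    rw [← summable_nat_add_iff 1]
    refine (hg.add hg').congr fun j => ?_
    rw [Nat.add_sub_cancel]
    push_cast
    ring
  rw [← summable_nat_add_iff 1]
  exact hg.add h

theorem hasDerivAt_ratSeq {b c p : ℝ → ℂ} {r t : ℝ} (hp : ‖p t‖ < 1)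
    (hr : p t * conj (p t) = 1 - r) (hc : c t * conj (c t) = r ^ 2)
    (hb' : HasDerivAt b (-Complex.I * (b t * conj (b t) * b t + 2 * b t * r
      + c t * conj (p t))) t)
    (hc' : HasDerivAt c (-Complex.I * (2 * b t * conj (b t) * c t
      + 2 * b t * p t * r + c t)) t)
    (hp' : HasDerivAt p (-Complex.I * (conj (b t) * c t + r * p t)) t) (n : ℕ) :
    HasDerivAt (fun τ => ratSeq (b τ) (c τ) (p τ) n)
      (-Complex.I * szegoNL (ratSeq (b t) (c t) (p t)) n) t := by
  obtain ⟨h0, h1⟩ := szegoNL_ratSeq hp hr hc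
  cases n with
  | zero =>
    rw [h0]
    exact hb'
  | succ j =>
    rw [h1]
    convert! hc'.mul (hp'.pow j) using 1
    simp only [Pi.pow_apply]
    ring

/-- The energy is differentiable along a `C²` curve solving the Szegő equation. -/
theorem differentiable_energy {u : ℝ → Hardy} (hu : Differentiable ℝ u)
    (hu' : Differentiable ℝ (deriv u)) (h : ∀ t, deriv u t = -Complex.I • nonlin (u t)) :
    Differentiable ℝ fun t => ‖mulOp (u t) (u t)‖ ^ 2 := by
  have e : (fun t => ‖mulOp (u t) (u t)‖ ^ 2)
      = fun t => Complex.reCLM ⟪u t, Complex.I • deriv u t⟫_ℂ := by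
    funext t
    rw [h, smul_smul, mul_neg, Complex.I_mul_I, neg_neg, one_smul, inner_nonlin_right,
      Complex.reCLM_apply]
    exact (inner_self_eq_norm_sq (𝕜 := ℂ) _).symm
  rw [e]
  exact Complex.reCLM.differentiable.comp (hu.inner ℂ (hu'.const_smul Complex.I))

theorem IsSzegoSolution.hasDerivAt {u : ℝ → Hardy} (hu : IsSzegoSolution 1 u) (t : ℝ) :
    HasDerivAt u (-Complex.I • nonlin (u t)) t := by
  have hd := (hu.2.1.differentiable (by simp) t).hasDerivAt
  have e : -Complex.I • nonlin (u t) = deriv u t := by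
    ext n
    have h1 : HasDerivAt (fun τ => u τ n) (deriv u t n) t :=
      ((lp.evalCLM ℂ (fun _ : ℕ => ℂ) 2 n).restrictScalars ℝ).hasFDerivAt.comp_hasDerivAt t hd
    have h2 : HasDerivAt (fun τ => u τ n) (-Complex.I * szegoNL (u t) n) t := hu.2.2 t n
    rw [h1.unique h2, lp.coeFn_smul, Pi.smul_apply, nonlin_apply (hu.1 t).inW, smul_eq_mul]
  rwa [e]

theorem IsSzegoSolution.eq_ratSeq {ε : ℝ} (hε : ε ≠ 0) {u : ℝ → Hardy}
    (hu : IsSzegoSolution 1 u)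
    (h0 : ∀ n, u 0 n = ratSeq (szB ε 0) (szC ε 0) (szP ε 0) n) (t : ℝ) (n : ℕ) :
    u t n = ratSeq (szB ε t) (szC ε t) (szP ε t) n := by
  set ρ := 2 / Real.sqrt (4 + ε ^ 2) with hρ
  set M := |ε| + (2 + ε ^ 2)
  set N := M ^ 3 + 2 * M ^ 2 + 2 * M + 1 with hN
  have hρ0 : 0 ≤ ρ := by positivity
  have hM0 : 0 ≤ M := by positivity
  have hρ1 : ρ < 1 := by
    have : 0 < ε ^ 2 := by positivity
    rw [hρ, div_lt_one (Real.sqrt_pos.2 (by positivity))]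
    exact Real.lt_sqrt_of_sq_lt (by linarith)
  have hMN : M + 1 ≤ N := by
    have : 0 ≤ M ^ 3 + 2 * M ^ 2 + M := by positivity
    linarith
  set s : ℝ → ℕ → ℂ := fun t => ratSeq (szB ε t) (szC ε t) (szP ε t) with hs
  have hβ : Summable fun n => N * ratBound ρ n := (summable_ratBound hρ0 hρ1).mul_left N
  have hsβ : ∀ t n, ‖s t n‖ ≤ N * ratBound ρ n := fun t => by
    obtain ⟨r, hr0, hr1, hp, hb, hc, -⟩ := sz_ode ε t
    exact norm_ratSeq_le hb hc hp hMN
  have hsW : ∀ t, InW (s t) := fun t =>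
    Summable.of_nonneg_of_le (fun _ => norm_nonneg _) (hsβ t) hβ
  set v : ℝ → Hardy := fun t => mulOp (s t) (lp.single 2 0 1) with hv
  have hvs : ∀ t, (v t : ℕ → ℂ) = s t := fun t => funext fun n => mulOp_single_zero (hsW t) n
  have hz : ∀ t n, (-Complex.I • nonlin (v t) : Hardy) n = -Complex.I * szegoNL (s t) n := by
    intro t n
    rw [lp.coeFn_smul, Pi.smul_apply, nonlin_apply (by rw [hvs]; exact hsW t), hvs, smul_eq_mul]
  have huv := weak_strong_uniqueness (v := v) (z := fun t => -Complex.I • nonlin (v t)) hβ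
    (fun t => (hu.1 t).inW) hu.hasDerivAt
    (differentiable_energy (hu.2.1.differentiable (by simp))
      ((hu.2.1.iterate_deriv 1).differentiable (by simp)) fun t => (hu.hasDerivAt t).deriv)
    (fun t n => by rw [hvs]; exact hsβ t n)
    (fun t n => by
      obtain ⟨r, hr0, hr1, hp, hb, hc, hr, hcr, -⟩ := sz_ode ε t
      rw [hz, norm_mul, norm_neg, Complex.norm_I, one_mul]
      exact norm_szegoNL_ratSeq_le hb hc hp hρ1 hr0 hr1 hr hcr le_rfl n)
    (fun t n => by
      obtain ⟨r, hr0, hr1, hp, hb, hc, hr, hcr, hb', hc', hp'⟩ := sz_ode ε t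
      simp only [hz, hvs]
      exact hasDerivAt_ratSeq (hp.trans_lt hρ1) hr hcr hb' hc' hp' n)
    (fun _ => rfl) (by ext n; rw [hvs]; exact h0 n) t
  rw [huv, hvs]

/-- **Section 4 (the example)**: the solution of the cubic Szegő equation with datum
`u₀^ε(x) = e^{ix} + ε`, `ε ≠ 0`, is
`u^ε(t,x) = (a^ε(t)e^{ix} + b^ε(t))/(1 - p^ε(t)e^{ix})`; equivalently its Fourier coefficients
are `û(t,0) = b^ε(t)` and `û(t,n) = a^ε(t) p^ε(t)^{n-1} + b^ε(t) p^ε(t)^n` for `n ≥ 1`. -/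
theorem statement9 (ε : ℝ) (hε : ε ≠ 0) (u : ℝ → Hardy)
    (hsol : ∀ s : ℝ, 1 / 2 < s → IsSzegoSolution s u)
    (h00 : coeffs (u 0) 0 = ε) (h01 : coeffs (u 0) 1 = 1)
    (h0n : ∀ n : ℕ, 2 ≤ n → coeffs (u 0) n = 0) (t : ℝ) :
    coeffs (u t) 0 = szB ε t ∧
      ∀ n : ℕ, 1 ≤ n →
        coeffs (u t) n = szA ε t * szP ε t ^ (n - 1) + szB ε t * szP ε t ^ n := by
  have h0 : ∀ n, u 0 n = ratSeq (szB ε 0) (szC ε 0) (szP ε 0) n := by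
    intro n
    match n with
    | 0 => simpa [coeffs, ratSeq, szB] using h00
    | 1 => simpa [coeffs, ratSeq, szC] using h01
    | j + 2 => simpa [coeffs, ratSeq, szP] using h0n (j + 2) (by omega)
  have h := (hsol 1 (by norm_num)).eq_ratSeq hε h0 t
  refine ⟨h 0, fun n hn => ?_⟩
  obtain ⟨j, rfl⟩ := Nat.exists_eq_add_of_le' hn
  refine (h (j + 1)).trans ?_
  rw [ratSeq, ← szA_add_szB_mul_szP, Nat.add_sub_cancel]
  ring

end
end
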